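/- arXiv:0803.0461 — 2 statements merged into one kernel-verified Lean document; each statement's English description precedes it below -/
import Mathlib

section
/- Let (R,𝔪) be a commutative Noetherian local ring, 𝔞 an ideal of R, and N a finitely generated R-module. Suppose there exists x ∈ R such that the radical of 𝔞 + (x) equals 𝔪 (i.e. ara(𝔪/𝔞) ≤ 1). Then q_𝔞(N) = sup{ i ∈ ℕ : Supp_R(H^i_𝔞(N)) ⊄ {𝔪} }, where both suprema are taken to be −∞ when the corresponding set is empty. -/
/-!
STATEMENT 13: Let (R,𝔪) be a commutative Noetherian local ring, 𝔞 an ideal of R, and N a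
finitely generated R-module. Suppose there exists x ∈ R with rad(𝔞 + (x)) = 𝔪 (i.e.
ara(𝔪/𝔞) ≤ 1). Then q_𝔞(N) = sup{ i : Supp_R(H^i_𝔞(N)) ⊄ {𝔪} }, both suprema being computed
in `WithBot ℕ∞` (so an empty set has supremum ⊥ = −∞).
-/

open CategoryTheory Opposite

universe u

noncomputable section

namespace CategoryTheory.ProjectiveResolution
variable {R : Type u} [CommRing R] {X X' : ModuleCat.{u} R}

/-- `ProjectiveResolution.extMk` as a linear map on cocycles. -/
def extMkLinear (P : ProjectiveResolution X) (Y : ModuleCat.{u} R) (n : ℕ) :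
    LinearMap.ker (Linear.leftComp R Y (P.complex.d (n + 1) n)) →ₗ[R] Abelian.Ext.{u} X Y n where
  toFun f := P.extMk f.1 (n + 1) rfl f.2
  map_add' f g := (P.add_extMk _ _ _ rfl f.2 g.2).symm
  map_smul' r f := by
    have h := (Abelian.Ext.smul_eq_comp_mk₀ (P.extMk f.1 (n + 1) rfl f.2) r).trans
      (P.extMk_comp_mk₀ f.1 (n + 1) rfl f.2 (r • 𝟙 Y))
    refine Eq.trans ?_ h.symm
    congr 1

/-- Cycles of `Hom(P, Y)`, viewed as morphisms annihilated by the differential of `P`. -/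
def cyclesToKer (P : ProjectiveResolution X) (Y : ModuleCat.{u} R) (n : ℕ) :
    (P.complex.linearYonedaObj R Y).cycles n →ₗ[R]
    LinearMap.ker (Linear.leftComp R Y (P.complex.d (n + 1) n)) :=
  LinearMap.codRestrict _ ((P.complex.linearYonedaObj R Y).iCycles n).hom fun z ↦
    congr($((P.complex.linearYonedaObj R Y).iCycles_d n (n + 1)).hom z)

lemma cyclesToKer_surjective (P : ProjectiveResolution X) (Y : ModuleCat.{u} R) (n : ℕ) :
    Function.Surjective (P.cyclesToKer Y n) := by
  intro f
  refine ⟨(P.complex.linearYonedaObj R Y).cyclesMk f.1 (n + 1) (by simp) f.2, Subtype.ext ?_⟩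
  exact (P.complex.linearYonedaObj R Y).i_cyclesMk f.1 (n + 1) (by simp) f.2

lemma toCycles_comp_cyclesToKer (P : ProjectiveResolution X) (Y : ModuleCat.{u} R) (n m : ℕ)
   (z : P.complex.X m ⟶ Y) :
    (P.cyclesToKer Y n (((P.complex.linearYonedaObj R Y).toCycles m n).hom z)).1 =
      P.complex.d n m ≫ z := by
  exact congr($((P.complex.linearYonedaObj R Y).toCycles_i m n).hom z)

/-- The class in `Ext` of a cycle of `Hom(P, Y)`. -/
def cyclesToExt (P : ProjectiveResolution X) (Y : ModuleCat.{u} R) (n : ℕ) :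
    (P.complex.linearYonedaObj R Y).cycles n →ₗ[R] Abelian.Ext.{u} X Y n :=
  P.extMkLinear Y n ∘ₗ P.cyclesToKer Y n

lemma cyclesToExt_surjective (P : ProjectiveResolution X) (Y : ModuleCat.{u} R) (n : ℕ) :
    Function.Surjective (P.cyclesToExt Y n) := by
  intro e
  obtain ⟨f, hf, rfl⟩ := P.extMk_surjective e (n + 1) rfl
  obtain ⟨z, hz⟩ := P.cyclesToKer_surjective Y n ⟨f, hf⟩
  refine ⟨z, ?_⟩
  change P.extMkLinear Y n (P.cyclesToKer Y n z) = _
  rw [hz]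
  rfl

lemma extMk_zero_eq_zero_iff (P : ProjectiveResolution X) (Y : ModuleCat.{u} R)
    (f : P.complex.X 0 ⟶ Y) (hf : P.complex.d 1 0 ≫ f = 0) :
    P.extMk f 1 rfl hf = 0 ↔ f = 0 := by
  refine ⟨fun h ↦ ?_, fun h ↦ by subst h; simp⟩
  simp only [← P.extEquivCohomologyClass.apply_eq_iff_eq,
    extEquivCohomologyClass_extMk, extEquivCohomologyClass_zero,
    CochainComplex.HomComplex.CohomologyClass.mk_eq_zero_iff] at h
  rw [CochainComplex.HomComplex.Cocycle.toSingleMk_mem_coboundaries_iff _ _ _ _ _ 1 (by lia)] at h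
  obtain ⟨g, hg⟩ := h
  have hz : P.cochainComplex.d (-(0 : ℕ)) 1 = 0 :=
    (P.cochainComplex.isZero_of_isStrictlyLE 0 1 (by lia)).eq_of_tgt _ _
  rw [hz, Limits.zero_comp] at hg
  rw [← cancel_epi (P.cochainComplexXIso (-(0 : ℕ)) 0 rfl).hom]
  simpa using hg.symm

lemma cyclesToExt_eq_zero_iff (P : ProjectiveResolution X) (Y : ModuleCat.{u} R) (n : ℕ)
    (z) : P.cyclesToExt Y n z = 0 ↔ ((P.complex.linearYonedaObj R Y).homologyπ n).hom z = 0 := by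
  have hinj : Function.Injective ((P.complex.linearYonedaObj R Y).iCycles n).hom :=
    (ModuleCat.mono_iff_injective _).1 inferInstance
  rcases n with _ | n
  · have h1 : Function.Injective ((P.complex.linearYonedaObj R Y).homologyπ 0).hom := by
      have := (P.complex.linearYonedaObj R Y).isIso_homologyπ 0 0 (by simp) (by
        apply HomologicalComplex.shape; simp)
      exact (ModuleCat.mono_iff_injective _).1 inferInstance
    rw [map_eq_zero_iff _ h1]
    refine (P.extMk_zero_eq_zero_iff Y _ (P.cyclesToKer Y 0 z).2).trans ?_
    exact map_eq_zero_iff _ hinj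
  · refine (P.extMk_eq_zero_iff (P.cyclesToKer Y (n + 1) z).1 (n + 2) rfl
      (P.cyclesToKer Y (n + 1) z).2 n rfl).trans ?_
    have hS := ShortComplex.exact_of_g_is_cokernel
      (.mk _ _ ((P.complex.linearYonedaObj R Y).toCycles_comp_homologyπ n (n + 1)))
      ((P.complex.linearYonedaObj R Y).homologyIsCokernel n (n + 1) (by simp))
    rw [ShortComplex.moduleCat_exact_iff] at hS
    constructor
    · rintro ⟨g, hg⟩
      have : z = ((P.complex.linearYonedaObj R Y).toCycles n (n + 1)).hom g := by
        apply hinj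
        exact hg.symm.trans (P.toCycles_comp_cyclesToKer Y (n + 1) n g).symm
      rw [this]
      exact congr($((P.complex.linearYonedaObj R Y).toCycles_comp_homologyπ n (n + 1)).hom g)
    · intro h
      obtain ⟨g, hg⟩ := hS z h
      refine ⟨g, ?_⟩
      rw [← hg]
      exact (P.toCycles_comp_cyclesToKer Y (n + 1) n g).symm

lemma homologyπ_surj (K : CochainComplex (ModuleCat.{u} R) ℕ) (n : ℕ) :
  Function.Surjective (K.homologyπ n).hom := (ModuleCat.epi_iff_surjective _).1 inferInstance

/-- The homology of `Hom(P, Y)` computes `Ext`. -/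
def homologyExtEquiv (P : ProjectiveResolution X) (Y : ModuleCat.{u} R) (n : ℕ) :
    (P.complex.linearYonedaObj R Y).homology n ≃ₗ[R] Abelian.Ext.{u} X Y n :=
  ((((P.complex.linearYonedaObj R Y).homologyπ n).hom.quotKerEquivOfSurjective
    (homologyπ_surj _ n)).symm.trans
    (Submodule.quotEquivOfEq _ _ (by ext z; exact (P.cyclesToExt_eq_zero_iff Y n z).symm))).trans
    ((P.cyclesToExt Y n).quotKerEquivOfSurjective (P.cyclesToExt_surjective Y n))

lemma homologyExtEquiv_π (P : ProjectiveResolution X) (Y : ModuleCat.{u} R) (n : ℕ) (z) :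
    P.homologyExtEquiv Y n (((P.complex.linearYonedaObj R Y).homologyπ n).hom z) =
      P.cyclesToExt Y n z := by
  simp only [homologyExtEquiv, LinearEquiv.trans_apply]
  have : (((P.complex.linearYonedaObj R Y).homologyπ n).hom.quotKerEquivOfSurjective
      (homologyπ_surj _ n)).symm (((P.complex.linearYonedaObj R Y).homologyπ n).hom z) =
      Submodule.Quotient.mk z := by
    rw [LinearEquiv.symm_apply_eq]; rfl
  rw [this]
  rfl

/-- The map of cochain complexes induced by a morphism of resolutions. -/
def linearYonedaMap {P P' : ChainComplex (ModuleCat.{u} R) ℕ} (φ : P' ⟶ P)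
    (Y : ModuleCat.{u} R) : P.linearYonedaObj R Y ⟶ P'.linearYonedaObj R Y where
  f i := ((linearYoneda R (ModuleCat.{u} R)).obj Y).map (φ.f i).op
  comm' i j _ := by
    ext z
    exact (φ.comm_assoc j i z).symm

lemma unop_comp_iso_hom {C : Type*} [Category C] {A A' B B' : Cᵒᵖ} {H H' : C}
    {l : A' ⟶ A} {i' : A' ≅ B'} {i : A ≅ B} {G : B' ⟶ B} (h : l ≫ i.hom = i'.hom ≫ G)
    {o' : B' ≅ op H'} {o : B ≅ op H} {ψ : H ⟶ H'} (h2 : G ≫ o.hom = o'.hom ≫ ψ.op) :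
    l.unop ≫ (i'.unop.symm ≪≫ o'.unop.symm).hom = (i.unop.symm ≪≫ o.unop.symm).hom ≫ ψ := by
  have h3 : l = i'.hom ≫ o'.hom ≫ ψ.op ≫ o.inv ≫ i.inv := by
    rw [← reassoc_of% h2, ← reassoc_of% h]
    simp
  subst h3
  have e1 : i'.hom.unop ≫ i'.inv.unop = 𝟙 _ := by rw [← unop_comp]; simp
  have e2 : o'.hom.unop ≫ o'.inv.unop = 𝟙 _ := by rw [← unop_comp]; simp
  simp

lemma isoExt_hom_naturality (P : ProjectiveResolution X) (P' : ProjectiveResolution X') {g : X' ⟶ X}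
    (φ : Hom P' P g) (Y : ModuleCat.{u} R) (n : ℕ) :
    ((Ext R (ModuleCat.{u} R) n).map g.op).app Y ≫ (P'.isoExt n Y).hom =
     (P.isoExt n Y).hom ≫ HomologicalComplex.homologyMap (linearYonedaMap φ.hom Y) n :=
  unop_comp_iso_hom (ProjectiveResolution.isoLeftDerivedObj_hom_naturality g P' P φ.hom
    φ.hom_f_zero_comp_π_f_zero ((linearYoneda R (ModuleCat.{u} R)).obj Y).rightOp n)
    (HomologicalComplex.homologyOp_hom_naturality (linearYonedaMap φ.hom Y) n)

lemma homologyExtEquiv_naturality (P : ProjectiveResolution X) (P' : ProjectiveResolution X') {g : X' ⟶ X}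
    (φ : Hom P' P g) (Y : ModuleCat.{u} R) (n : ℕ) (h) :
    P'.homologyExtEquiv Y n ((HomologicalComplex.homologyMap (linearYonedaMap φ.hom Y) n).hom h) =
      (Abelian.Ext.mk₀ g).comp (P.homologyExtEquiv Y n h) (zero_add n) := by
  obtain ⟨z, rfl⟩ := homologyπ_surj _ _ h
  have h1 : (HomologicalComplex.homologyMap (linearYonedaMap φ.hom Y) n).hom
      (((P.complex.linearYonedaObj R Y).homologyπ n).hom z) =
      ((P'.complex.linearYonedaObj R Y).homologyπ n).hom
        ((HomologicalComplex.cyclesMap (linearYonedaMap φ.hom Y) n).hom z) :=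
    congr($(HomologicalComplex.homologyπ_naturality (linearYonedaMap φ.hom Y) n).hom z)
  rw [h1, homologyExtEquiv_π, homologyExtEquiv_π]
  refine Eq.trans ?_ (mk₀_comp_extMk (P.cyclesToKer Y n z).1 (n + 1) rfl (P.cyclesToKer Y n z).2 φ).symm
  change P'.extMk (P'.cyclesToKer Y n _).1 (n + 1) rfl (P'.cyclesToKer Y n _).2 = _
  congr 1
  exact congr($(HomologicalComplex.cyclesMap_i (linearYonedaMap φ.hom Y) n).hom z)

/-- `Ext` defined by left deriving `Hom` agrees with `Abelian.Ext`. -/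
def derivedExtEquiv (X Y : ModuleCat.{u} R) (n : ℕ) :
    ((Ext R (ModuleCat.{u} R) n).obj (op X)).obj Y ≃ₗ[R] Abelian.Ext.{u} X Y n :=
  ((projectiveResolution X).isoExt n Y).toLinearEquiv.trans ((projectiveResolution X).homologyExtEquiv Y n)

lemma derivedExtEquiv_naturality (Y : ModuleCat.{u} R) (n : ℕ) (g : X' ⟶ X) (e) :
    derivedExtEquiv X' Y n ((((Ext R (ModuleCat.{u} R) n).map g.op).app Y).hom e) =
      (Abelian.Ext.mk₀ g).comp (derivedExtEquiv X Y n e) (zero_add n) := by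
  let φ : Hom (projectiveResolution X') (projectiveResolution X) g :=
    ⟨lift g _ _, by simpa using lift_commutes_zero g _ _⟩
  have h1 : ((projectiveResolution X').isoExt n Y).toLinearEquiv
      ((((Ext R (ModuleCat.{u} R) n).map g.op).app Y).hom e) =
      (HomologicalComplex.homologyMap (linearYonedaMap φ.hom Y) n).hom
        (((projectiveResolution X).isoExt n Y).toLinearEquiv e) :=
    ConcreteCategory.congr_hom (isoExt_hom_naturality _ _ φ Y n) e
  rw [derivedExtEquiv, derivedExtEquiv, LinearEquiv.trans_apply, LinearEquiv.trans_apply, h1,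
    homologyExtEquiv_naturality]

end CategoryTheory.ProjectiveResolution

namespace localCohomology
variable {R : Type u} [CommRing R] (𝔞 : Ideal R)

/-- The module `R ⧸ 𝔞 ^ t`. -/
def quotPow (t : ℕ) : ModuleCat.{u} R := ModuleCat.of R (R ⧸ 𝔞 ^ t)

/-- The projection `R ⧸ 𝔞 ^ t → R ⧸ 𝔞 ^ s` for `s ≤ t`. -/
def quotPowMap {s t : ℕ} (h : s ≤ t) : quotPow 𝔞 t ⟶ quotPow 𝔞 s :=
  (ringModIdeals (idealPowersDiagram 𝔞)).map (homOfLE h).op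

lemma quotPowMap_self (t : ℕ) : quotPowMap 𝔞 (le_refl t) = 𝟙 _ :=
  (ringModIdeals (idealPowersDiagram 𝔞)).map_id (op t)

lemma quotPowMap_comp {s t v : ℕ} (h : s ≤ t) (h' : t ≤ v) :
    quotPowMap 𝔞 h' ≫ quotPowMap 𝔞 h = quotPowMap 𝔞 (h.trans h') :=
  ((ringModIdeals (idealPowersDiagram 𝔞)).map_comp (homOfLE h').op (homOfLE h).op).symm

/-- Precomposition on `Ext`, as a linear map. -/
def extMap {X X' : ModuleCat.{u} R} (g : X' ⟶ X) (N : ModuleCat.{u} R) (i : ℕ) :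
    Abelian.Ext.{u} X N i →ₗ[R] Abelian.Ext.{u} X' N i where
  toFun e := (Abelian.Ext.mk₀ g).comp e (zero_add i)
  map_add' e e' := by simp
  map_smul' r e := by simp

/-- The transition maps of the system `Ext (R ⧸ 𝔞 ^ t) N i`. -/
def transition (N : ModuleCat.{u} R) (i s t : ℕ) (h : s ≤ t) := extMap (quotPowMap 𝔞 h) N i

instance (N : ModuleCat.{u} R) (i : ℕ) : DirectedSystem
   (fun t ↦ Abelian.Ext.{u} (quotPow 𝔞 t) N i) (fun s t h ↦ transition 𝔞 N i s t h) where
  map_self t x := by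
    simp [transition, extMap, quotPowMap_self]
  map_map s t v h h' x := by
    simp only [transition, extMap, LinearMap.coe_mk, AddHom.coe_mk]
    rw [← Abelian.Ext.comp_assoc_of_second_deg_zero, Abelian.Ext.mk₀_comp_mk₀, quotPowMap_comp]

/-- Local cohomology as a direct limit of modules `Ext (R ⧸ 𝔞 ^ t) N i`. -/
abbrev LC (N : ModuleCat.{u} R) (i : ℕ) : Type u :=
  Module.DirectLimit (fun t ↦ Abelian.Ext.{u} (quotPow 𝔞 t) N i) (transition 𝔞 N i)

/-- The terms of the diagram defining `localCohomology` in terms of `Abelian.Ext`. -/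
def derivedExtEquiv (N : ModuleCat.{u} R) (i t : ℕ) :
    (((diagram (idealPowersDiagram 𝔞) i).obj (op (op t))).obj N) ≃ₗ[R]
      Abelian.Ext.{u} (quotPow 𝔞 t) N i :=
  ProjectiveResolution.derivedExtEquiv (quotPow 𝔞 t) N i

lemma derivedExtEquiv_map (N : ModuleCat.{u} R) (i : ℕ) {s t : ℕ} (h : s ≤ t) (x) :
    derivedExtEquiv 𝔞 N i t ((((diagram (idealPowersDiagram 𝔞) i).map (homOfLE h).op.op).app N).hom x) =
      transition 𝔞 N i s t h (derivedExtEquiv 𝔞 N i s x) :=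
  ProjectiveResolution.derivedExtEquiv_naturality N i (quotPowMap 𝔞 h) x

/-- The diagram defining `localCohomology`, evaluated at `N`. -/
def evalDiagram (N : ModuleCat.{u} R) (i : ℕ) : ℕᵒᵖᵒᵖ ⥤ ModuleCat.{u} R :=
  diagram (idealPowersDiagram 𝔞) i ⋙ (evaluation _ _).obj N

/-- The colimit cocone defining `localCohomology`, evaluated at `N`. -/
def evalCocone (N : ModuleCat.{u} R) (i : ℕ) : Limits.Cocone (evalDiagram 𝔞 N i) :=
  ((evaluation _ _).obj N).mapCocone (Limits.colimit.cocone (diagram (idealPowersDiagram 𝔞) i))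

/-- Evaluation at `N` preserves the colimit defining `localCohomology`. -/
def isColimitEvalCocone (N : ModuleCat.{u} R) (i : ℕ) : Limits.IsColimit (evalCocone 𝔞 N i) :=
  Limits.isColimitOfPreserves ((evaluation _ _).obj N)
    (Limits.colimit.isColimit (diagram (idealPowersDiagram 𝔞) i))

/-- The canonical map from `Ext (R ⧸ 𝔞 ^ t) N i` to local cohomology. -/
def toColim (N : ModuleCat.{u} R) (i t : ℕ) :
    Abelian.Ext.{u} (quotPow 𝔞 t) N i →ₗ[R] (localCohomology 𝔞 i).obj N :=
  ((evalCocone 𝔞 N i).ι.app (op (op t))).hom ∘ₗ (derivedExtEquiv 𝔞 N i t).symm.toLinearMap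

lemma toColim_derivedExtEquiv (N : ModuleCat.{u} R) (i t : ℕ) (x) :
    toColim 𝔞 N i t (derivedExtEquiv 𝔞 N i t x) = ((evalCocone 𝔞 N i).ι.app (op (op t))).hom x :=
  congrArg ((evalCocone 𝔞 N i).ι.app (op (op t))).hom
    ((derivedExtEquiv 𝔞 N i t).symm_apply_apply x)

instance : Limits.PreservesColimitsOfShape ℕᵒᵖᵒᵖ (forget (ModuleCat.{u} R)) := by
  have : Limits.PreservesFilteredColimitsOfSize.{u, u} (forget (ModuleCat.{u} R)) :=
    ModuleCat.FilteredColimits.forget_preservesFilteredColimits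
  have := Limits.preservesSmallestFilteredColimits_of_preservesFilteredColimits.{u, u}
    (forget (ModuleCat.{u} R))
  infer_instance

lemma toColim_transition (N : ModuleCat.{u} R) (i s t : ℕ) (h : s ≤ t) (e) :
    toColim 𝔞 N i t (transition 𝔞 N i s t h e) = toColim 𝔞 N i s e := by
  obtain ⟨x, rfl⟩ := (derivedExtEquiv 𝔞 N i s).surjective e
  rw [← derivedExtEquiv_map, toColim_derivedExtEquiv, toColim_derivedExtEquiv]
  exact ConcreteCategory.congr_hom ((evalCocone 𝔞 N i).w (homOfLE h).op.op) x

lemma exists_toColim_eq (N : ModuleCat.{u} R) (i : ℕ) (z : (localCohomology 𝔞 i).obj N) :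
    ∃ t e, toColim 𝔞 N i t e = z := by
  obtain ⟨j, y, h⟩ := Limits.Concrete.isColimit_exists_rep _ (isColimitEvalCocone 𝔞 N i) z
  exact ⟨j.unop.unop, derivedExtEquiv 𝔞 N i _ y, (toColim_derivedExtEquiv 𝔞 N i _ y).trans h⟩

lemma exists_transition_eq_zero (N : ModuleCat.{u} R) (i s : ℕ) (e) (he : toColim 𝔞 N i s e = 0) :
    ∃ t h, transition 𝔞 N i s t h e = 0 := by
  obtain ⟨x, rfl⟩ := (derivedExtEquiv 𝔞 N i s).surjective e
  rw [toColim_derivedExtEquiv] at he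
  have h0 : ((evalCocone 𝔞 N i).ι.app (op (op s))).hom x =
      ((evalCocone 𝔞 N i).ι.app (op (op s))).hom 0 := he.trans (map_zero _).symm
  obtain ⟨k, f, g, hfg⟩ :=
    (Limits.Concrete.isColimit_rep_eq_iff_exists _ (isColimitEvalCocone 𝔞 N i) x _).1 h0
  have hk : s ≤ k.unop.unop := leOfHom f.unop.unop
  refine ⟨k.unop.unop, hk, ?_⟩
  rw [← derivedExtEquiv_map]
  have h1 : (((diagram (idealPowersDiagram 𝔞) i).map (homOfLE hk).op.op).app N).hom x = 0 :=
    hfg.trans (map_zero ((evalDiagram 𝔞 N i).map g).hom)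
  rw [h1, map_zero]

/-- `LC` is `localCohomology`. -/
def LCEquiv (N : ModuleCat.{u} R) (i : ℕ) : LC 𝔞 N i ≃ₗ[R] (localCohomology 𝔞 i).obj N :=
  LinearEquiv.ofBijective
    (Module.DirectLimit.lift R ℕ _ (transition 𝔞 N i) (toColim 𝔞 N i) (toColim_transition 𝔞 N i)) <| by
    constructor
    · rw [injective_iff_map_eq_zero]
      intro z hz
      obtain ⟨s, e, rfl⟩ := Module.DirectLimit.exists_of z
      rw [Module.DirectLimit.lift_of] at hz
      obtain ⟨t, h, ht⟩ := exists_transition_eq_zero 𝔞 N i s e hz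
      rw [← Module.DirectLimit.of_f (hij := h), ht, map_zero]
    · intro z
      obtain ⟨s, e, rfl⟩ := exists_toColim_eq 𝔞 N i z
      exact ⟨Module.DirectLimit.of R ℕ _ _ s e, Module.DirectLimit.lift_of _ _ _⟩

end localCohomology

namespace localCohomology
namespace LC
variable {R : Type u} [CommRing R] (𝔞 : Ideal R) {N N' : ModuleCat.{u} R}

/-- The canonical map from `Ext (R ⧸ 𝔞 ^ t) N i` to `LC 𝔞 N i`. -/
def of (N : ModuleCat.{u} R) (i t : ℕ) : Abelian.Ext.{u} (quotPow 𝔞 t) N i →ₗ[R] LC 𝔞 N i :=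
  Module.DirectLimit.of R ℕ _ (transition 𝔞 N i) t

lemma exists_of {i : ℕ} (z : LC 𝔞 N i) : ∃ t e, of 𝔞 N i t e = z :=
  Module.DirectLimit.exists_of z

lemma of_transition (i : ℕ) {s t : ℕ} (h : s ≤ t) (e) :
    of 𝔞 N i t (transition 𝔞 N i s t h e) = of 𝔞 N i s e :=
  Module.DirectLimit.of_f

lemma exists_transition_eq_zero {i s : ℕ} {e} (he : of 𝔞 N i s e = 0) :
    ∃ t h, transition 𝔞 N i s t h e = 0 :=
  Module.DirectLimit.of.zero_exact he

/-- Postcomposition on `Ext`, as a linear map. -/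
def extPostcomp (X : ModuleCat.{u} R) {a b c : ℕ} (θ : Abelian.Ext.{u} N N' b) (h : a + b = c) :
    Abelian.Ext.{u} X N a →ₗ[R] Abelian.Ext.{u} X N' c where
  toFun e := e.comp θ h
  map_add' e e' := by simp
  map_smul' r e := by simp

lemma extPostcomp_transition {a b c : ℕ} (θ : Abelian.Ext.{u} N N' b) (h : a + b = c)
    (s t : ℕ) (hst : s ≤ t) :
    extPostcomp (quotPow 𝔞 t) θ h ∘ₗ transition 𝔞 N a s t hst =
      transition 𝔞 N' c s t hst ∘ₗ extPostcomp (quotPow 𝔞 s) θ h := by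
  ext e
  exact Abelian.Ext.comp_assoc (.mk₀ (quotPowMap 𝔞 hst)) e θ (zero_add a) h (by lia)

/-- Postcomposition with a class in `Ext N N' b` on local cohomology. -/
def comp {a b c : ℕ} (θ : Abelian.Ext.{u} N N' b) (h : a + b = c) : LC 𝔞 N a →ₗ[R] LC 𝔞 N' c :=
  Module.DirectLimit.map (fun t ↦ extPostcomp (quotPow 𝔞 t) θ h) (extPostcomp_transition 𝔞 θ h)

lemma comp_of {a b c : ℕ} (θ : Abelian.Ext.{u} N N' b) (h : a + b = c) (t : ℕ) (e) :
    comp 𝔞 θ h (of 𝔞 N a t e) = of 𝔞 N' c t (e.comp θ h) :=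
  Module.DirectLimit.map_apply_of _ _ _

lemma exact_comp {N'' : ModuleCat.{u} R} {a b c b' c' : ℕ} (θ : Abelian.Ext.{u} N N' b)
    (h : a + b = c) (θ' : Abelian.Ext.{u} N' N'' b') (h' : c + b' = c')
    (H : ∀ (t : ℕ) (e : Abelian.Ext.{u} (quotPow 𝔞 t) N' c), e.comp θ' h' = 0 →
      ∃ e' : Abelian.Ext.{u} (quotPow 𝔞 t) N a, e'.comp θ h = e)
    (z) (hz : comp 𝔞 θ' h' z = 0) : ∃ w, comp 𝔞 θ h w = z := by
  obtain ⟨s, e, rfl⟩ := exists_of 𝔞 z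
  rw [comp_of] at hz
  obtain ⟨t, hst, ht⟩ := exists_transition_eq_zero 𝔞 hz
  obtain ⟨e', he'⟩ := H t (transition 𝔞 _ _ s t hst e)
    ((LinearMap.congr_fun (extPostcomp_transition 𝔞 θ' h' s t hst) e).trans ht)
  refine ⟨of 𝔞 _ _ t e', ?_⟩
  rw [comp_of, he', of_transition]

section
variable {S : ShortComplex (ModuleCat.{u} R)}

lemma exact₂ (hS : S.ShortExact) (i : ℕ) (z) (hz : comp 𝔞 (.mk₀ S.g) (add_zero i) z = 0) :
    ∃ w, comp 𝔞 (.mk₀ S.f) (add_zero i) w = z :=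
  exact_comp 𝔞 _ _ _ _ (fun _ e he ↦ Abelian.Ext.covariant_sequence_exact₂ _ hS e he) z hz

lemma exact₃ (hS : S.ShortExact) (i : ℕ) (z) (hz : comp 𝔞 hS.extClass (rfl : i + 1 = i + 1) z = 0) :
    ∃ w, comp 𝔞 (.mk₀ S.g) (add_zero i) w = z :=
  exact_comp 𝔞 _ _ _ _ (fun _ e he ↦ Abelian.Ext.covariant_sequence_exact₃ _ hS e _ he) z hz

lemma exact₁ (hS : S.ShortExact) (i : ℕ) (z) (hz : comp 𝔞 (.mk₀ S.f) (add_zero (i + 1)) z = 0) :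
    ∃ w, comp 𝔞 hS.extClass (rfl : i + 1 = i + 1) w = z :=
  exact_comp 𝔞 _ _ _ _ (fun _ e he ↦ Abelian.Ext.covariant_sequence_exact₁ _ hS e he _) z hz

end

lemma comp_mk₀_smul_id (i : ℕ) (r : R) (z : LC 𝔞 N i) :
    comp 𝔞 (.mk₀ (r • 𝟙 N)) (add_zero i) z = r • z := by
  obtain ⟨s, e, rfl⟩ := exists_of 𝔞 z
  rw [comp_of, ← Abelian.Ext.smul_eq_comp_mk₀, map_smul]

lemma smul_eq_zero_of_annihilates (i : ℕ) (r : R) (hr : ∀ n : N, r • n = 0) (z : LC 𝔞 N i) :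
    r • z = 0 := by
  have h : r • 𝟙 N = 0 := by ext n; exact hr n
  obtain ⟨s, e, rfl⟩ := exists_of 𝔞 z
  rw [← map_smul, Abelian.Ext.smul_eq_comp_mk₀, h]
  simp

lemma exists_pow_smul_eq_zero (i : ℕ) (z : LC 𝔞 N i) : ∃ t, ∀ r ∈ 𝔞 ^ t, r • z = 0 := by
  obtain ⟨t, e, rfl⟩ := exists_of 𝔞 z
  refine ⟨t, fun r hr ↦ ?_⟩
  have h : r • 𝟙 (quotPow 𝔞 t) = 0 := by
    ext n
    obtain ⟨n, rfl⟩ := Submodule.Quotient.mk_surjective _ n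
    exact (Submodule.Quotient.mk_eq_zero _).2 (Ideal.mul_mem_right _ _ hr)
  have h2 : e = (Abelian.Ext.mk₀ (𝟙 _)).comp e (zero_add i) := by simp
  rw [← map_smul, h2, ← Abelian.Ext.smul_comp, ← Abelian.Ext.mk₀_smul, h]
  simp

lemma subsingleton_of_injective [Injective N] (i : ℕ) : Subsingleton (LC 𝔞 N (i + 1)) := by
  refine subsingleton_of_forall_eq 0 fun z ↦ ?_
  obtain ⟨s, e, rfl⟩ := exists_of 𝔞 z
  rw [Abelian.Ext.eq_zero_of_injective e, map_zero]

/-- The generator of `R ⧸ 𝔞 ^ t`. -/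
def quotPowOne (t : ℕ) : quotPow 𝔞 t := Submodule.Quotient.mk (1 : R)

/-- Evaluation of a homomorphism `R ⧸ 𝔞 ^ t → N` at the generator. -/
def evalOne (N : ModuleCat.{u} R) (t : ℕ) : Abelian.Ext.{u} (quotPow 𝔞 t) N 0 →ₗ[R] N where
  toFun e := (Abelian.Ext.linearEquiv₀ (R := R) e).hom (quotPowOne 𝔞 t)
  map_add' e e' := by rw [map_add]; rfl
  map_smul' r e := by rw [map_smul]; rfl

lemma evalOne_mk₀ (t : ℕ) (f : quotPow 𝔞 t ⟶ N) :
    evalOne 𝔞 N t (.mk₀ f) = f.hom (quotPowOne 𝔞 t) := by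
  have : Abelian.Ext.linearEquiv₀ (R := R) (Abelian.Ext.mk₀ f) = f :=
    Abelian.Ext.homEquiv₀.apply_symm_apply f
  simp only [evalOne, LinearMap.coe_mk, AddHom.coe_mk]
  rw [this]

lemma evalOne_injective (t : ℕ) : Function.Injective (evalOne 𝔞 N t) := by
  rw [injective_iff_map_eq_zero]
  intro e he
  obtain ⟨f, rfl⟩ := Abelian.Ext.homEquiv₀.symm.surjective e
  rw [Abelian.Ext.homEquiv₀_symm_apply] at he ⊢
  rw [evalOne_mk₀] at he
  have : f = 0 := by
    ext n
    obtain ⟨n, rfl⟩ := Submodule.Quotient.mk_surjective _ n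
    have h : (Submodule.Quotient.mk n : R ⧸ 𝔞 ^ t) = n • quotPowOne 𝔞 t := by
      change _ = Submodule.Quotient.mk (n • (1 : R))
      rw [smul_eq_mul, mul_one]
    have h2 : f.hom (n • quotPowOne 𝔞 t) = 0 := by rw [map_smul, he, smul_zero]
    exact (congrArg f.hom h).trans h2
  rw [this, Abelian.Ext.mk₀_zero]

lemma evalOne_transition (s t : ℕ) (h : s ≤ t) (e) :
    evalOne 𝔞 N t (transition 𝔞 N 0 s t h e) = evalOne 𝔞 N s e := by
  obtain ⟨f, rfl⟩ := Abelian.Ext.homEquiv₀.symm.surjective e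
  rw [Abelian.Ext.homEquiv₀_symm_apply]
  have : transition 𝔞 N 0 s t h (.mk₀ f) = .mk₀ (quotPowMap 𝔞 h ≫ f) :=
    Abelian.Ext.mk₀_comp_mk₀ _ _
  rw [this, evalOne_mk₀, evalOne_mk₀]
  rfl

/-- The canonical map from the zeroth local cohomology of `N` to `N`. -/
def eval (N : ModuleCat.{u} R) : LC 𝔞 N 0 →ₗ[R] N :=
  Module.DirectLimit.lift R ℕ _ (transition 𝔞 N 0) (evalOne 𝔞 N) (evalOne_transition 𝔞)

lemma eval_of (t : ℕ) (e) : eval 𝔞 N (of 𝔞 N 0 t e) = evalOne 𝔞 N t e :=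
  Module.DirectLimit.lift_of _ _ _

lemma eval_injective : Function.Injective (eval 𝔞 N) := by
  rw [injective_iff_map_eq_zero]
  intro z hz
  obtain ⟨s, e, rfl⟩ := exists_of 𝔞 z
  rw [eval_of, map_eq_zero_iff _ (evalOne_injective 𝔞 s)] at hz
  rw [hz, map_zero]

lemma eval_comp (f : N ⟶ N') (z : LC 𝔞 N 0) :
    eval 𝔞 N' (comp 𝔞 (.mk₀ f) (add_zero 0) z) = f.hom (eval 𝔞 N z) := by
  obtain ⟨s, e, rfl⟩ := exists_of 𝔞 z
  obtain ⟨g, rfl⟩ := Abelian.Ext.homEquiv₀.symm.surjective e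
  rw [Abelian.Ext.homEquiv₀_symm_apply, comp_of, eval_of, eval_of, Abelian.Ext.mk₀_comp_mk₀,
    evalOne_mk₀, evalOne_mk₀]
  rfl

lemma exists_eval_eq {t : ℕ} (n : N) (hn : ∀ r ∈ 𝔞 ^ t, r • n = 0) : ∃ z, eval 𝔞 N z = n := by
  let f : quotPow 𝔞 t ⟶ N := ModuleCat.ofHom (Submodule.liftQ (𝔞 ^ t)
    (LinearMap.toSpanSingleton R N n)
    (fun r hr ↦ hn r hr))
  refine ⟨of 𝔞 N 0 t (.mk₀ f), ?_⟩
  rw [eval_of, evalOne_mk₀]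
  exact one_smul R n

end LC

end localCohomology

section
variable {R : Type*} [CommRing R] {M : Type*} [AddCommGroup M] [Module R M]

/-- Melkersson's criterion for a principal ideal. -/
theorem isArtinian_of_isArtinian_ker_lsmul (y : R) (hM : ∀ z : M, ∃ n : ℕ, y ^ n • z = 0)
    [IsArtinian R (LinearMap.ker (LinearMap.lsmul R M y))] : IsArtinian R M := by
  rw [← monotone_stabilizes_iff_artinian]
  intro L
  set K := LinearMap.ker (LinearMap.lsmul R M y)
  let A (j n : ℕ) : Submodule R K :=
    (Submodule.map (LinearMap.lsmul R M (y ^ n)) (OrderDual.ofDual (L j))).comap K.subtype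
  have mem_A (j n : ℕ) (k : K) : k ∈ A j n ↔ ∃ l ∈ OrderDual.ofDual (L j), y ^ n • l = (k : M) :=
    Iff.rfl
  have hL {j j' : ℕ} (h : j ≤ j') : OrderDual.ofDual (L j') ≤ OrderDual.ofDual (L j) :=
    L.monotone h
  have hA {j j' n n' : ℕ} (hj : j ≤ j') (hn : n ≤ n') : A j' n' ≤ A j n := by
    intro k hk
    obtain ⟨l, hl, h⟩ := (mem_A _ _ _).1 hk
    refine (mem_A _ _ _).2 ⟨y ^ (n' - n) • l, Submodule.smul_mem _ _ (hL hj hl), ?_⟩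
    rw [smul_smul, ← pow_add, Nat.add_sub_cancel' hn, h]
  obtain ⟨n₀, hn₀⟩ := IsArtinian.monotone_stabilizes
    (⟨fun n ↦ OrderDual.toDual (A n n), fun _ _ h ↦ hA h h⟩ : ℕ →o (Submodule R K)ᵒᵈ)
  have H (n : ℕ) := IsArtinian.monotone_stabilizes
    (⟨fun j ↦ OrderDual.toDual (A j n), fun _ _ h ↦ hA h le_rfl⟩ : ℕ →o (Submodule R K)ᵒᵈ)
  choose J hJ using H
  let j₀ := max n₀ ((Finset.range n₀).sup J)
  have key (j : ℕ) (hj : j₀ ≤ j) (n : ℕ) : A j₀ n ≤ A j n := by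
    by_cases hn : n < n₀
    · have h₁ : J n ≤ j₀ := (Finset.le_sup (Finset.mem_range.2 hn)).trans (le_max_right _ _)
      have e₁ : A (J n) n = A j₀ n := hJ n j₀ h₁
      have e₂ : A (J n) n = A j n := hJ n j (h₁.trans hj)
      exact (e₁.symm.trans e₂).le
    · have e : A n₀ n₀ = A (max j n) (max j n) :=
        hn₀ _ ((le_max_left _ _).trans (hj.trans (le_max_left _ _)))
      exact (hA (le_max_left _ _) (not_lt.1 hn)).trans
        (e.le.trans (hA (le_max_left _ _) (le_max_right _ _)))
  refine ⟨j₀, fun j hj ↦ le_antisymm (L.monotone hj) ?_⟩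
  change OrderDual.ofDual (L j₀) ≤ OrderDual.ofDual (L j)
  suffices ∀ (n : ℕ) (z : M), z ∈ OrderDual.ofDual (L j₀) → y ^ n • z = 0 →
      z ∈ OrderDual.ofDual (L j) from fun z hz ↦ (hM z).elim fun n hn ↦ this n z hz hn
  intro n
  induction n with
  | zero =>
    intro z _ h
    rw [pow_zero, one_smul] at h
    exact h ▸ Submodule.zero_mem _
  | succ n ih =>
    intro z hz h
    have hK : y ^ n • z ∈ K := by
      rw [LinearMap.mem_ker, LinearMap.lsmul_apply, smul_smul, ← pow_succ', h]
    obtain ⟨l, hl, hlz⟩ := (mem_A _ _ _).1 (key j hj n ((mem_A j₀ n ⟨_, hK⟩).2 ⟨z, hz, rfl⟩))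
    have := ih (z - l) (Submodule.sub_mem _ hz (hL hj hl)) (by rw [smul_sub, hlz, sub_self])
    simpa using Submodule.add_mem _ this hl

theorem isArtinian_of_ker_le_range {M' M'' : Type*} [AddCommGroup M'] [Module R M']
    [AddCommGroup M''] [Module R M''] [IsArtinian R M'] [IsArtinian R M''] (f : M' →ₗ[R] M)
    (g : M →ₗ[R] M'') (h : LinearMap.ker g ≤ LinearMap.range f) : IsArtinian R M := by
  have : IsArtinian R (LinearMap.range f) := isArtinian_of_surjective _ _ f.surjective_rangeRestrict
  have : IsArtinian R (LinearMap.ker g) :=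
    isArtinian_of_injective _ (Submodule.inclusion_injective h)
  exact isArtinian_of_range_eq_ker (LinearMap.ker g).subtype g (by simp)

/-- The `y`-power torsion submodule of a Noetherian module. -/
theorem exists_powTorsion [IsNoetherian R M] (y : R) : ∃ (T : Submodule R M) (k : ℕ),
    (∀ n ∈ T, y ^ k • n = 0) ∧ ∀ n, y • n ∈ T → n ∈ T := by
  let T : ℕ →o Submodule R M := ⟨fun k ↦ LinearMap.ker (LinearMap.lsmul R M (y ^ k)), by
    intro a b h n hn
    rw [LinearMap.mem_ker, LinearMap.lsmul_apply] at hn ⊢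
    rw [← Nat.sub_add_cancel h, pow_add, mul_smul, hn, smul_zero]⟩
  have mem_T (k : ℕ) (n : M) : n ∈ T k ↔ y ^ k • n = 0 := Iff.rfl
  obtain ⟨k, hk⟩ := monotone_stabilizes_iff_noetherian.2 ‹_› T
  refine ⟨T k, k, fun n ↦ (mem_T k n).1, fun n hn ↦ ?_⟩
  rw [hk (k + 1) k.le_succ, mem_T, pow_succ, mul_smul]
  exact (mem_T _ _).1 hn

theorem isArtinian_of_maximalIdeal_le_radical [IsNoetherianRing R] [IsLocalRing R]
    [Module.Finite R M] (h : IsLocalRing.maximalIdeal R ≤ (Module.annihilator R M).radical) :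
    IsArtinian R M := by
  set I := Module.annihilator R M
  have : IsArtinianRing (R ⧸ I) := by
    rw [isArtinianRing_iff_isNoetherianRing_krullDimLE_zero]
    refine ⟨inferInstance, Ring.krullDimLE_zero_iff.2 fun P hP ↦ ?_⟩
    have hP' := Ideal.comap_isPrime (Ideal.Quotient.mk I) P
    have hI : I ≤ P.comap (Ideal.Quotient.mk I) := by
      intro r hr
      rw [Ideal.mem_comap, Ideal.Quotient.eq_zero_iff_mem.2 hr]
      exact P.zero_mem
    have hm := h.trans (hP'.radical_le_iff.2 hI)
    have hmax := (IsLocalRing.maximalIdeal.isMaximal R).eq_of_le hP'.ne_top hm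
    have : (P.comap (Ideal.Quotient.mk I)).IsMaximal := hmax ▸ inferInstance
    rw [← Ideal.map_comap_of_surjective _ Ideal.Quotient.mk_surjective P]
    refine (Ideal.map_eq_top_or_isMaximal_of_surjective _ Ideal.Quotient.mk_surjective
      this).resolve_left ?_
    rw [Ideal.map_comap_of_surjective _ Ideal.Quotient.mk_surjective P]
    exact hP.ne_top
  have htors : Module.IsTorsionBySet R M I := Module.isTorsionBySet_annihilator R M
  let := htors.module
  have : Module.Finite (R ⧸ I) M := Module.Finite.of_restrictScalars_finite R _ _
  have : IsArtinian (R ⧸ I) M := inferInstance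
  let φ : Submodule R M → Submodule (R ⧸ I) M := fun p ↦
    { p with smul_mem' := by
              intro c x hx
              obtain ⟨r, rfl⟩ := Ideal.Quotient.mk_surjective c
              exact p.smul_mem r hx }
  have : StrictMono φ := fun p q h ↦ h
  exact this.wellFoundedLT

end

section
variable {R : Type u} [CommRing R]

/-- The submodule of elements annihilated by a power of the ideal `𝔞`. -/
def Ideal.powTorsion (𝔞 : Ideal R) (E : Type*) [AddCommGroup E] [Module R E] : Submodule R E where
  carrier := {n | ∃ t, ∀ r ∈ 𝔞 ^ t, r • n = 0}
  zero_mem' := ⟨0, fun r _ ↦ smul_zero r⟩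
  add_mem' := by
    rintro a b ⟨s, hs⟩ ⟨t, ht⟩
    refine ⟨max s t, fun r hr ↦ ?_⟩
    rw [smul_add, hs r (Ideal.pow_le_pow_right (le_max_left _ _) hr),
      ht r (Ideal.pow_le_pow_right (le_max_right _ _) hr), add_zero]
  smul_mem' := by
    rintro c a ⟨s, hs⟩
    exact ⟨s, fun r hr ↦ by rw [smul_comm, hs r hr, smul_zero]⟩

theorem Ideal.injective_powTorsion [IsNoetherianRing R] (𝔞 : Ideal R) (E : Type u) [AddCommGroup E]
    [Module R E] [Module.Injective R E] : Module.Injective R (𝔞.powTorsion E) := by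
  refine Module.Baer.injective fun J f ↦ ?_
  obtain ⟨n, hn⟩ : ∃ n, ∀ j, ∀ r ∈ 𝔞 ^ n, r • f j = 0 := by
    let T : ℕ →o Submodule R J :=
      { toFun n := { carrier := {j | ∀ r ∈ 𝔞 ^ n, r • f j = 0}
                     zero_mem' := fun r _ ↦ by rw [map_zero, smul_zero]
                     add_mem' := fun ha hb r hr ↦ by
                      rw [map_add, smul_add, ha r hr, hb r hr, add_zero]
                     smul_mem' := fun c a ha r hr ↦ by
                      rw [map_smul, smul_comm, ha r hr, smul_zero] }
        monotone' := fun a b h j hj r hr ↦ hj r (Ideal.pow_le_pow_right h hr) }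
    obtain ⟨n, hn⟩ := monotone_stabilizes_iff_noetherian.2 (inferInstance : IsNoetherian R J) T
    refine ⟨n, fun j ↦ ?_⟩
    obtain ⟨t, ht⟩ := (f j).2
    have h₁ : j ∈ T (max n t) := fun r hr ↦
      Subtype.ext (ht r (Ideal.pow_le_pow_right (le_max_right _ _) hr))
    rw [← hn _ (le_max_left _ _)] at h₁
    exact h₁
  obtain ⟨k, hk⟩ := Ideal.exists_pow_inf_eq_pow_smul 𝔞 (J : Submodule R R)
  set m := k + n
  have hf (j : J) (hj : (j : R) ∈ 𝔞 ^ m) : f j = 0 := by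
    have h₁ : (j : R) ∈ 𝔞 ^ n • (J : Submodule R R) := by
      have h₂ : (j : R) ∈ 𝔞 ^ m • (⊤ : Submodule R R) ⊓ J :=
        ⟨by simpa using hj, j.2⟩
      rw [hk m (Nat.le_add_right k n), Nat.add_sub_cancel_left] at h₂
      exact Submodule.smul_mono le_rfl inf_le_right h₂
    suffices ∃ h : (j : R) ∈ J, f ⟨j, h⟩ = 0 from this.2
    refine Submodule.smul_induction_on (p := fun x ↦ ∃ h : x ∈ J, f ⟨x, h⟩ = 0) h₁ ?_ ?_
    · intro r hr x hx
      exact ⟨J.smul_mem r hx, (f.map_smul r ⟨x, hx⟩).trans (hn _ r hr)⟩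
    · rintro a b ⟨ha, ha'⟩ ⟨hb, hb'⟩
      exact ⟨J.add_mem ha hb, (f.map_add ⟨a, ha⟩ ⟨b, hb⟩).trans (by rw [ha', hb', add_zero])⟩
  let p : Submodule R J := Submodule.comap (Submodule.subtype J) (𝔞 ^ m)
  let F : (J ⧸ p) →ₗ[R] E := p.liftQ ((𝔞.powTorsion E).subtype ∘ₗ f) fun j hj ↦ by
    rw [LinearMap.mem_ker, LinearMap.comp_apply, hf j hj, map_zero]
  let ι : (J ⧸ p) →ₗ[R] (R ⧸ 𝔞 ^ m) := p.mapQ (𝔞 ^ m) (Submodule.subtype J) le_rfl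
  have hι : Function.Injective ι := by
    rw [injective_iff_map_eq_zero]
    intro x hx
    obtain ⟨j, rfl⟩ := Submodule.Quotient.mk_surjective _ x
    exact (Submodule.Quotient.mk_eq_zero _).2 ((Submodule.Quotient.mk_eq_zero (𝔞 ^ m)).1 hx)
  obtain ⟨H, hH⟩ := Module.Injective.out ι hι F
  refine ⟨LinearMap.codRestrict _ (H ∘ₗ Submodule.mkQ (𝔞 ^ m)) fun c ↦ ⟨m, fun r hr ↦ ?_⟩, ?_⟩
  · rw [← map_smul]
    have : r • c ∈ 𝔞 ^ m := Ideal.mul_mem_right _ _ hr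
    rw [LinearMap.comp_apply, Submodule.mkQ_apply, (Submodule.Quotient.mk_eq_zero _).2 this,
      map_zero]
  · intro x hx
    exact Subtype.ext (hH (Submodule.Quotient.mk ⟨x, hx⟩))

end

namespace localCohomology.LC
variable {R : Type u} [CommRing R] (𝔞 : Ideal R)

lemma comp_extClass_comp_g {S : ShortComplex (ModuleCat.{u} R)} (hS : S.ShortExact) (i : ℕ)
    (z : LC 𝔞 S.X₂ i) :
    comp 𝔞 hS.extClass (rfl : i + 1 = i + 1) (comp 𝔞 (.mk₀ S.g) (add_zero i) z) = 0 := by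
  obtain ⟨s, e, rfl⟩ := exists_of 𝔞 z
  rw [comp_of, comp_of, Abelian.Ext.comp_assoc_of_second_deg_zero, hS.comp_extClass,
    Abelian.Ext.comp_zero, map_zero]

/-- The short complex `0 → L → M → M ⧸ L → 0`. -/
abbrev quotientShortComplex {L M : Type u} [AddCommGroup L] [Module R L] [AddCommGroup M]
    [Module R M] (f : L →ₗ[R] M) : ShortComplex (ModuleCat.{u} R) :=
  .moduleCatMk f (LinearMap.range f).mkQ (LinearMap.range_mkQ_comp f)

lemma quotientShortComplex_shortExact {L M : Type u} [AddCommGroup L] [Module R L] [AddCommGroup M]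
    [Module R M] (f : L →ₗ[R] M) (hf : Function.Injective f) :
    (quotientShortComplex f).ShortExact := by
  refine ModuleCat.shortComplex_shortExact _ ?_ hf (Submodule.mkQ_surjective _)
  exact LinearMap.exact_iff.2 (Submodule.ker_mkQ _)

lemma subsingleton_succ_of_torsion [IsNoetherianRing R] (i : ℕ) (L : ModuleCat.{u} R)
    (hL : ∀ n : L, ∃ t, ∀ r ∈ 𝔞 ^ t, r • n = 0)
    (hi : ∀ C : ModuleCat.{u} R, (∀ n : C, ∃ t, ∀ r ∈ 𝔞 ^ t, r • n = 0) → ∀ z : LC 𝔞 C i,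
      z = 0 ∨ i = 0) :
    Subsingleton (LC 𝔞 L (i + 1)) := by
  let E := Injective.under L
  have : Injective (ModuleCat.of R E) := Injective.injective_under L
  have hE : Module.Injective R E := Module.injective_module_of_injective_object R E
  have hE' := 𝔞.injective_powTorsion E
  let E' := 𝔞.powTorsion E
  have : Injective (ModuleCat.of R E') := Module.injective_object_of_injective_module R E'
  let f : L →ₗ[R] E' := LinearMap.codRestrict E' (Injective.ι L).hom fun n ↦ by
    obtain ⟨t, ht⟩ := hL n
    exact ⟨t, fun r hr ↦ by rw [← map_smul, ht r hr, map_zero]⟩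
  have hf : Function.Injective f := fun a b h ↦
    (ModuleCat.mono_iff_injective (Injective.ι L)).1 inferInstance (congrArg Subtype.val h)
  have hS := quotientShortComplex_shortExact f hf
  have hE₁ : ∀ n : E', ∃ t, ∀ r ∈ 𝔞 ^ t, r • n = 0 := fun n ↦ by
    obtain ⟨t, ht⟩ := n.2
    exact ⟨t, fun r hr ↦ Subtype.ext (ht r hr)⟩
  have hC : ∀ n : E' ⧸ LinearMap.range f, ∃ t, ∀ r ∈ 𝔞 ^ t, r • n = 0 := fun n ↦ by
    obtain ⟨n, rfl⟩ := Submodule.Quotient.mk_surjective _ n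
    obtain ⟨t, ht⟩ := hE₁ n
    exact ⟨t, fun r hr ↦ by rw [← Submodule.Quotient.mk_smul, ht r hr, Submodule.Quotient.mk_zero]⟩
  have hE₂ : Subsingleton (LC 𝔞 (ModuleCat.of R E') (i + 1)) := subsingleton_of_injective 𝔞 i
  refine subsingleton_of_forall_eq 0 fun z ↦ ?_
  obtain ⟨w, rfl⟩ := exact₁ 𝔞 hS i z (hE₂.elim _ _)
  obtain h | rfl := hi _ hC w
  · exact (congrArg _ h).trans (map_zero _)
  · obtain ⟨n, hn⟩ := Submodule.Quotient.mk_surjective (LinearMap.range f) (eval 𝔞 _ w)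
    obtain ⟨t, ht⟩ := hE₁ n
    obtain ⟨v, hv⟩ := exists_eval_eq 𝔞 (N := ModuleCat.of R E') n ht
    have : comp 𝔞 (.mk₀ (quotientShortComplex f).g) (add_zero 0) v = w := by
      apply eval_injective 𝔞
      exact (eval_comp 𝔞 (quotientShortComplex f).g v).trans
        ((congrArg (quotientShortComplex f).g.hom hv).trans hn)
    rw [← this]
    exact comp_extClass_comp_g 𝔞 hS 0 v

/-- Torsion modules have no local cohomology in positive degrees. -/
theorem subsingleton_of_torsion [IsNoetherianRing R] (i : ℕ) (L : ModuleCat.{u} R)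
    (hL : ∀ n : L, ∃ t, ∀ r ∈ 𝔞 ^ t, r • n = 0) : Subsingleton (LC 𝔞 L (i + 1)) := by
  induction i generalizing L with
  | zero => exact subsingleton_succ_of_torsion 𝔞 0 L hL fun C hC z ↦ Or.inr rfl
  | succ i ih =>
    exact subsingleton_succ_of_torsion 𝔞 (i + 1) L hL fun C hC z ↦
      Or.inl ((ih C hC).elim _ _)

end localCohomology.LC

namespace localCohomology.LC
variable {R : Type u} [CommRing R] (𝔞 : Ideal R)

lemma exists_surjective_quotSMulTop {M : Type*} [AddCommGroup M] [Module R M] (y : R) :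
    ∃ π : M →ₗ[R] QuotSMulTop y M, Function.Surjective π ∧ ∀ q : QuotSMulTop y M, y • q = 0 := by
  refine ⟨Submodule.mkQ _, Submodule.mkQ_surjective _, fun q ↦ ?_⟩
  obtain ⟨n, rfl⟩ := Submodule.Quotient.mk_surjective _ q
  exact (Submodule.Quotient.mk_eq_zero _).2 (Submodule.smul_mem_pointwise_smul n y ⊤ trivial)

/-- If `y` is regular on `N'` and `H^i(N')` is `y`-power torsion, then Artinianness of
`H^{i-1}(N' / y N')` implies that of `H^i(N')`. -/
lemma isArtinian_of_isSMulRegular (y : R) (i : ℕ) (N' : ModuleCat.{u} R) (hy : IsSMulRegular N' y)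
    (htors : ∀ z : LC 𝔞 N' i, ∃ k : ℕ, y ^ k • z = 0)
    (hQ : ∀ j, j + 1 = i → IsArtinian R (LC 𝔞 (ModuleCat.of R (QuotSMulTop y N')) j)) :
    IsArtinian R (LC 𝔞 N' i) := by
  have : IsArtinian R (LinearMap.ker (LinearMap.lsmul R (LC 𝔞 N' i) y)) := by
    cases i with
    | zero =>
      suffices LinearMap.ker (LinearMap.lsmul R (LC 𝔞 N' 0) y) = ⊥ by
        rw [this]; infer_instance
      refine LinearMap.ker_eq_bot'.2 fun z hz ↦ eval_injective 𝔞 (hy ?_)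
      change y • _ = y • _
      rw [← map_smul, map_zero, smul_zero]
      exact (congrArg _ hz).trans (map_zero _)
    | succ j =>
      have := hQ j rfl
      have hS := hy.smulShortComplex_shortExact
      let δ : LC 𝔞 (ModuleCat.of R (QuotSMulTop y N')) j →ₗ[R] LC 𝔞 N' (j + 1) :=
        comp 𝔞 hS.extClass rfl
      have h : LinearMap.ker (LinearMap.lsmul R (LC 𝔞 N' (j + 1)) y) ≤ LinearMap.range δ := by
        intro z hz
        obtain ⟨w, hw⟩ := exact₁ 𝔞 hS j z ((comp_mk₀_smul_id 𝔞 (j + 1) y z).trans hz)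
        exact ⟨w, hw⟩
      have : IsArtinian R (LinearMap.range δ) :=
        isArtinian_of_surjective _ _ δ.surjective_rangeRestrict
      exact isArtinian_of_injective _ (Submodule.inclusion_injective h)
  exact isArtinian_of_isArtinian_ker_lsmul y htors

variable [IsNoetherianRing R]

/-- Reduction of Artinianness of `H^i(N)`, when it is `y`-power torsion, to finite modules
annihilated by a power of `y` and to lower degree. -/
lemma isArtinian_of_powTorsion (y : R) (i : ℕ) (N : Type u) [AddCommGroup N] [Module R N]
    [Module.Finite R N] (htors : ∀ z : LC 𝔞 (ModuleCat.of R N) i, ∃ k : ℕ, y ^ k • z = 0)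
    (H : ∀ j, j ≤ i → ∀ (Q : Type u) [AddCommGroup Q] [Module R Q] [Module.Finite R Q],
      Module.annihilator R N ≤ Module.annihilator R Q → (∃ k, y ^ k ∈ Module.annihilator R Q) →
        IsArtinian R (LC 𝔞 (ModuleCat.of R Q) j)) :
    IsArtinian R (LC 𝔞 (ModuleCat.of R N) i) := by
  obtain ⟨T, k, hT, hT'⟩ := exists_powTorsion (M := N) y
  have hS := quotientShortComplex_shortExact T.subtype T.subtype_injective
  let N' := N ⧸ LinearMap.range T.subtype
  have hreg : IsSMulRegular N' y := by
    refine (isSMulRegular_iff_right_eq_zero_of_smul).2 fun a ha ↦ ?_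
    obtain ⟨a, rfl⟩ := Submodule.Quotient.mk_surjective _ a
    have h : y • a ∈ LinearMap.range T.subtype := (Submodule.Quotient.mk_eq_zero _).1 ha
    rw [Submodule.range_subtype] at h
    refine (Submodule.Quotient.mk_eq_zero _).2 ?_
    rw [Submodule.range_subtype]
    exact hT' _ h
  have h₁ : IsArtinian R (LC 𝔞 (quotientShortComplex T.subtype).X₁ i) := H i le_rfl T
    (LinearMap.annihilator_le_of_injective T.subtype T.subtype_injective)
    ⟨k, Module.mem_annihilator.2 fun n ↦ Subtype.ext (hT n n.2)⟩
  have h₃ : IsArtinian R (LC 𝔞 (quotientShortComplex T.subtype).X₃ i) := by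
    refine isArtinian_of_isSMulRegular 𝔞 y i (ModuleCat.of R N') hreg (fun z ↦ ?_) fun j hj ↦ ?_
    · have h : comp 𝔞 hS.extClass (rfl : i + 1 = i + 1) (y ^ k • z) = 0 :=
        (map_smul _ _ _).trans (smul_eq_zero_of_annihilates 𝔞 (N := ModuleCat.of R T) (i + 1) (y ^ k)
          (fun (n : T) ↦ Subtype.ext (hT n.1 n.2)) _)
      obtain ⟨w, hw⟩ := exact₃ 𝔞 hS i _ h
      obtain ⟨l, hl⟩ := htors w
      refine ⟨l + k, ?_⟩
      rw [pow_add, mul_smul]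
      exact (congrArg (y ^ l • ·) hw.symm).trans
        ((map_smul _ _ _).symm.trans ((congrArg _ hl).trans (map_zero _)))
    · obtain ⟨π, hπ, hy⟩ := exists_surjective_quotSMulTop (M := N') y
      have hπ' := hπ.comp (Submodule.mkQ_surjective (LinearMap.range T.subtype))
      have : Module.Finite R (QuotSMulTop y N') := Module.Finite.of_surjective π hπ
      exact H j (by lia) (QuotSMulTop y N') (LinearMap.annihilator_le_of_surjective
        (π ∘ₗ (LinearMap.range T.subtype).mkQ) hπ')
        ⟨1, (pow_one y).symm ▸ Module.mem_annihilator.2 hy⟩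
  exact isArtinian_of_ker_le_range
    (comp 𝔞 (.mk₀ (quotientShortComplex T.subtype).f) (add_zero i))
    (comp 𝔞 (.mk₀ (quotientShortComplex T.subtype).g) (add_zero i))
    fun z hz ↦ exact₂ 𝔞 hS i z hz

variable [IsLocalRing R]

lemma isArtinian_of_le_radical_annihilator (i : ℕ) (N : Type u) [AddCommGroup N] [Module R N]
    [Module.Finite R N]
    (hm : IsLocalRing.maximalIdeal R ≤ (𝔞 ⊔ Module.annihilator R N).radical)
    (h𝔞 : 𝔞 ≤ (Module.annihilator R N).radical) :
    IsArtinian R (LC 𝔞 (ModuleCat.of R N) i) := by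
  cases i with
  | zero =>
    have : IsArtinian R N := isArtinian_of_maximalIdeal_le_radical
      (hm.trans (Ideal.radical_le_radical_iff.2 (sup_le h𝔞 Ideal.le_radical)))
    exact isArtinian_of_injective (eval 𝔞 (ModuleCat.of R N)) (eval_injective 𝔞)
  | succ i =>
    obtain ⟨t, ht⟩ := Ideal.exists_pow_le_of_le_radical_of_fg h𝔞 (IsNoetherian.noetherian 𝔞)
    have := subsingleton_of_torsion 𝔞 i (ModuleCat.of R N)
      fun n ↦ ⟨t, fun r hr ↦ Module.mem_annihilator.1 (ht hr) n⟩
    infer_instance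

theorem isArtinian_of_maximalIdeal_le_radical_sup (i : ℕ) (N : Type u) [AddCommGroup N]
    [Module R N] [Module.Finite R N]
    (hm : IsLocalRing.maximalIdeal R ≤ (𝔞 ⊔ Module.annihilator R N).radical) :
    IsArtinian R (LC 𝔞 (ModuleCat.of R N) i) := by
  induction i using Nat.strong_induction_on generalizing N with | _ i ihi =>
  suffices ∀ s : Finset R, (s : Set R) ⊆ 𝔞 → ∀ (N : Type u) [AddCommGroup N]
      [Module R N] [Module.Finite R N],
      IsLocalRing.maximalIdeal R ≤ (𝔞 ⊔ Module.annihilator R N).radical →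
      𝔞 ≤ (Ideal.span (s : Set R) ⊔ Module.annihilator R N).radical →
      IsArtinian R (LC 𝔞 (ModuleCat.of R N) i) by
    obtain ⟨s, hs⟩ := IsNoetherian.noetherian 𝔞
    refine this s (hs ▸ Ideal.subset_span) N hm ?_
    rw [Ideal.span, hs]
    exact le_sup_left.trans Ideal.le_radical
  classical
  intro s
  induction s using Finset.induction_on with
  | empty =>
    intro _ N _ _ _ hm h𝔞
    rw [Finset.coe_empty, Ideal.span_empty, bot_sup_eq] at h𝔞
    exact isArtinian_of_le_radical_annihilator 𝔞 i N hm h𝔞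
  | insert y s _ ihs =>
    intro hs N _ _ _ hm h𝔞
    rw [Finset.coe_insert, Set.insert_subset_iff] at hs
    refine isArtinian_of_powTorsion 𝔞 y i N (fun z ↦ ?_) fun j hj Q _ _ _ hQ ⟨k, hk⟩ ↦ ?_
    · obtain ⟨t, ht⟩ := exists_pow_smul_eq_zero 𝔞 i z
      exact ⟨t, ht _ (Ideal.pow_mem_pow hs.1 t)⟩
    · have hm' : IsLocalRing.maximalIdeal R ≤ (𝔞 ⊔ Module.annihilator R Q).radical :=
        hm.trans (Ideal.radical_mono (sup_le_sup_left hQ 𝔞))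
      obtain hj | rfl := hj.lt_or_eq
      · exact ihi j hj Q hm'
      · refine ihs hs.2 Q hm' (h𝔞.trans (Ideal.radical_le_radical_iff.2 ?_))
        rw [Finset.coe_insert, Ideal.span_insert]
        refine sup_le (sup_le ?_ ?_) ?_
        · rw [Ideal.span_singleton_le_iff_mem]
          exact ⟨k, Ideal.mem_sup_right hk⟩
        · exact le_sup_left.trans Ideal.le_radical
        · exact (hQ.trans le_sup_right).trans Ideal.le_radical

theorem isArtinian_of_radical_sup_span_singleton (x : R)
    (hx : (𝔞 ⊔ Ideal.span {x}).radical = IsLocalRing.maximalIdeal R)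
    (i : ℕ) (N : Type u) [AddCommGroup N] [Module R N] [Module.Finite R N]
    (htors : ∀ z : LC 𝔞 (ModuleCat.of R N) i, ∃ k : ℕ, x ^ k • z = 0) :
    IsArtinian R (LC 𝔞 (ModuleCat.of R N) i) := by
  refine isArtinian_of_powTorsion 𝔞 x i N htors fun j _ Q _ _ _ _ ⟨k, hk⟩ ↦ ?_
  refine isArtinian_of_maximalIdeal_le_radical_sup 𝔞 j Q ?_
  rw [← hx, Ideal.radical_le_radical_iff]
  refine sup_le (le_sup_left.trans Ideal.le_radical) ?_
  rw [Ideal.span_singleton_le_iff_mem]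
  exact ⟨k, Ideal.mem_sup_right hk⟩

end localCohomology.LC

section
variable {R : Type*} [CommRing R] [IsLocalRing R] {M : Type*} [AddCommGroup M] [Module R M]

theorem Module.support_subset_closedPoint_of_isArtinian [IsArtinian R M] :
    Module.support R M ⊆ {IsLocalRing.closedPoint R} := by
  intro p hp
  obtain ⟨z, hz⟩ := Module.mem_support_iff_exists_annihilator.1 hp
  have hle : IsLocalRing.maximalIdeal R ≤ p.asIdeal := by
    intro x hx
    obtain ⟨n, ⟨_, hy⟩, h⟩ := IsArtinian.exists_pow_succ_smul_dvd x
      (⟨z, Submodule.mem_span_singleton_self z⟩ : R ∙ z)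
    obtain ⟨c, rfl⟩ := Submodule.mem_span_singleton.1 hy
    replace h : x ^ (n + 1) • c • z = x ^ n • z := congrArg Subtype.val h
    have hu : IsUnit (1 - x * c) := IsLocalRing.isUnit_one_sub_self_of_mem_nonunits _
      ((IsLocalRing.mem_maximalIdeal _).1 (Ideal.mul_mem_right _ _ hx))
    have hp : x ^ n * (1 - x * c) ∈ p.asIdeal := by
      refine hz ((Submodule.mem_annihilator_span_singleton _ _).2 ?_)
      rw [mul_sub, mul_one, sub_smul, ← mul_assoc, ← pow_succ, mul_smul (x ^ (n + 1)), h, sub_self]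
    exact p.2.mem_of_pow_mem n ((p.2.mem_or_mem hp).resolve_right
      fun h ↦ p.2.ne_top (Ideal.eq_top_of_isUnit_mem _ h hu))
  exact PrimeSpectrum.ext ((IsLocalRing.maximalIdeal.isMaximal R).eq_of_le p.2.ne_top hle).symm

theorem exists_pow_smul_eq_zero_of_support_subset {x : R}
    (hx : x ∈ IsLocalRing.maximalIdeal R)
    (h : Module.support R M ⊆ {IsLocalRing.closedPoint R}) (z : M) : ∃ k : ℕ, x ^ k • z = 0 := by
  by_contra! hz
  obtain ⟨p, hp, hzp, hpx⟩ := Ideal.exists_le_prime_disjoint (R ∙ z).annihilator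
    (Submonoid.powers x) (by
      rw [Set.disjoint_left]
      rintro _ h' ⟨k, rfl⟩
      exact hz k ((Submodule.mem_annihilator_span_singleton _ _).1 h'))
  have : (⟨p, hp⟩ : PrimeSpectrum R) ∈ Module.support R M :=
    Module.mem_support_iff_exists_annihilator.2 ⟨z, hzp⟩
  have h' : p = IsLocalRing.maximalIdeal R := congrArg PrimeSpectrum.asIdeal (h this)
  exact Set.disjoint_left.1 hpx (h' ▸ hx : x ∈ p) (Submonoid.mem_powers x)

end

end

theorem artinianness_dim_eq_sup_support_not_in_closedPoint
    {R : Type u} [CommRing R] [IsNoetherianRing R] [IsLocalRing R]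
    (𝔞 : Ideal R) (N : Type u) [AddCommGroup N] [Module R N] [Module.Finite R N]
    (h_ara : ∃ x : R, (𝔞 ⊔ Ideal.span {x}).radical = IsLocalRing.maximalIdeal R) :
    sSup ((fun i : ℕ => (i : WithBot ℕ∞)) ''
        { i : ℕ | ¬ IsArtinian R ((localCohomology 𝔞 i).obj (ModuleCat.of R N)) }) =
      sSup ((fun i : ℕ => (i : WithBot ℕ∞)) ''
        { i : ℕ | ¬ Module.support R ((localCohomology 𝔞 i).obj (ModuleCat.of R N)) ⊆
            {IsLocalRing.closedPoint R} }) := by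
  obtain ⟨x, hx⟩ := h_ara
  congr! 3
  ext i
  refine not_congr ⟨fun _ ↦ Module.support_subset_closedPoint_of_isArtinian, fun h ↦ ?_⟩
  have e := localCohomology.LCEquiv 𝔞 (ModuleCat.of R N) i
  have hxm : x ∈ IsLocalRing.maximalIdeal R :=
    hx ▸ Ideal.le_radical (Ideal.mem_sup_right (Ideal.mem_span_singleton_self x))
  have : IsArtinian R (localCohomology.LC 𝔞 (ModuleCat.of R N) i) := by
    refine localCohomology.LC.isArtinian_of_radical_sup_span_singleton 𝔞 x hx i N fun z ↦ ?_
    obtain ⟨k, hk⟩ := exists_pow_smul_eq_zero_of_support_subset hxm h (e z)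
    exact ⟨k, e.injective (by rw [map_smul, hk, map_zero])⟩
  exact isArtinian_of_linearEquiv e
end

section
/- Let R be a commutative Noetherian ring, 𝔞 an ideal of R, and N, L finitely generated R-modules with Supp_R(N) ⊆ Supp_R(L). If t is an integer such that H^i_𝔞(L) is Artinian for all i > t, then H^i_𝔞(N) is Artinian for all i > t. In particular q_𝔞(N) ≤ q_𝔞(L), and if Supp_R(N) = Supp_R(L) then q_𝔞(N) = q_𝔞(L). -/
/-!
STATEMENT 15: Let R be a commutative Noetherian ring, 𝔞 an ideal of R, and N, L finitely
generated R-modules with Supp_R(N) ⊆ Supp_R(L). If t is an integer such that H^i_𝔞(L) is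
Artinian for all i > t, then H^i_𝔞(N) is Artinian for all i > t (in particular
q_𝔞(N) ≤ q_𝔞(L), and if the supports are equal then q_𝔞(N) = q_𝔞(L)).
-/

open CategoryTheory Opposite

universe u

namespace ChainComplex

variable {D : Type*} [Category* D] [Abelian D] (K : ChainComplex D ℕ) {I : D}

/-- The morphism on homology induced by a morphism from a term of a chain complex that vanishes
on boundaries. -/
noncomputable def homologyDesc {n : ℕ} (k : K.X n ⟶ I) (hk : K.d (n + 1) n ≫ k = 0) :
    K.homology n ⟶ I :=
  K.homologyι n ≫ K.descOpcycles k (n + 1) (by simp) hk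

lemma homologyDesc_add {n : ℕ} (k l : K.X n ⟶ I) (hk : K.d (n + 1) n ≫ k = 0)
    (hl : K.d (n + 1) n ≫ l = 0) :
    K.homologyDesc (k + l) (by simp [hk, hl]) = K.homologyDesc k hk + K.homologyDesc l hl := by
  refine Eq.trans ?_ (Preadditive.comp_add _ _ _ _ _ _)
  rw [homologyDesc]
  congr 1
  simp [← cancel_epi (K.pOpcycles n)]

lemma homologyDesc_comp {n : ℕ} (k : K.X n ⟶ I) (hk : K.d (n + 1) n ≫ k = 0)
    {J : D} (l : I ⟶ J) :
    K.homologyDesc k hk ≫ l = K.homologyDesc (k ≫ l) (by simp [reassoc_of% hk]) := by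
  simp only [homologyDesc, Category.assoc]
  congr 1
  simp [← cancel_epi (K.pOpcycles n)]

lemma homologyMap_comp_homologyDesc {K L : ChainComplex D ℕ} (φ : K ⟶ L) {n : ℕ}
    (k : L.X n ⟶ I) (hk : L.d (n + 1) n ≫ k = 0) :
    HomologicalComplex.homologyMap φ n ≫ L.homologyDesc k hk =
      K.homologyDesc (φ.f n ≫ k) (by simp [← φ.comm_assoc, hk]) := by
  simp only [homologyDesc, HomologicalComplex.homologyι_naturality_assoc]
  congr 1
  simp

lemma homologyDesc_d_comp {n : ℕ} (k : K.X n ⟶ I) :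
    K.homologyDesc (K.d (n + 1) n ≫ k) (by simp) = 0 := by
  have h : K.descOpcycles (K.d (n + 1) n ≫ k) (n + 1 + 1) (by simp) (by simp) =
      K.fromOpcycles (n + 1) n ≫ k := by
    simp [← cancel_epi (K.pOpcycles (n + 1))]
  rw [homologyDesc, h]
  simp [← Category.assoc]

variable [Injective I]

lemma exists_homologyDesc_eq {n : ℕ} (h : K.homology n ⟶ I) :
    ∃ (k : K.X n ⟶ I) (hk : K.d (n + 1) n ≫ k = 0), K.homologyDesc k hk = h := by
  refine ⟨K.pOpcycles n ≫ Injective.factorThru h (K.homologyι n), by simp, ?_⟩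
  have : K.descOpcycles (K.pOpcycles n ≫ Injective.factorThru h (K.homologyι n)) (n + 1)
      (by simp) (by simp) = Injective.factorThru h (K.homologyι n) := by
    simp [← cancel_epi (K.pOpcycles n)]
  rw [homologyDesc, this, Injective.comp_factorThru]

lemma exists_of_homologyDesc_eq_zero {n : ℕ} (k : K.X (n + 1) ⟶ I)
    (hk : K.d (n + 1 + 1) (n + 1) ≫ k = 0) (h : K.homologyDesc k hk = 0) :
    ∃ g : K.X n ⟶ I, K.d (n + 1) n ≫ g = k := by
  have hex : (ShortComplex.mk (K.homologyι (n + 1)) (K.fromOpcycles (n + 1) n) (by simp)).Exact :=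
    ShortComplex.exact_of_f_is_kernel _ (K.homologyIsKernel (n + 1) n (by simp))
  refine ⟨hex.descToInjective _ h, ?_⟩
  have := hex.comp_descToInjective _ h
  dsimp at this
  rw [← HomologicalComplex.p_fromOpcycles, Category.assoc, this, HomologicalComplex.p_descOpcycles]

end ChainComplex

namespace CategoryTheory.ProjectiveResolution

variable {R : Type u} [CommRing R] {X Y : ModuleCat.{u} R} (P : ProjectiveResolution X)

/-- The complex of homomorphisms from a projective resolution, in the opposite category. -/
noncomputable def homComplexOp (P : ProjectiveResolution X) (Y : ModuleCat.{u} R) :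
    ChainComplex (ModuleCat.{u} R)ᵒᵖ ℕ :=
  ((((linearYoneda R (ModuleCat.{u} R)).obj Y).rightOp).mapHomologicalComplex _).obj P.complex

/-- `Ext` is the homology of the complex of homomorphisms. -/
noncomputable def opExtIso (P : ProjectiveResolution X) (Y : ModuleCat.{u} R) (n : ℕ) :
    op (((Ext R (ModuleCat.{u} R) n).obj (op X)).obj Y) ≅ (P.homComplexOp Y).homology n :=
  P.isoLeftDerivedObj ((linearYoneda R (ModuleCat.{u} R)).obj Y).rightOp n

/-- A homomorphism, regarded as an element of a term of the complex of homomorphisms. -/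
noncomputable def homComplexOpHom {n : ℕ} (f : P.complex.X n ⟶ Y) :
    (P.homComplexOp Y).X n ⟶ op (ModuleCat.of R R) :=
  Quiver.Hom.op (X := ModuleCat.of R R) (Y := ModuleCat.of R (P.complex.X n ⟶ Y))
    (ModuleCat.ofHom (LinearMap.toSpanSingleton R (P.complex.X n ⟶ Y) f))

lemma op_hom_ext {M : (ModuleCat.{u} R)ᵒᵖ} {f g : M ⟶ op (ModuleCat.of R R)}
    (h : f.unop.hom (1 : R) = g.unop.hom (1 : R)) : f = g :=
  Quiver.Hom.unop_inj (ModuleCat.hom_ext (LinearMap.ext_ring h))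

lemma homComplexOpHom_apply {n : ℕ} (f : P.complex.X n ⟶ Y) :
    (P.homComplexOpHom f).unop.hom (1 : R) = f :=
  one_smul R f

lemma d_comp_homComplexOpHom {m n : ℕ} (f : P.complex.X n ⟶ Y) :
    (P.homComplexOp Y).d m n ≫ P.homComplexOpHom f =
      P.homComplexOpHom (P.complex.d m n ≫ f) := by
  apply op_hom_ext
  change P.complex.d m n ≫ ((1 : R) • f) = (1 : R) • (P.complex.d m n ≫ f)
  simp

lemma homComplexOpHom_zero {n : ℕ} : P.homComplexOpHom (0 : P.complex.X n ⟶ Y) = 0 :=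
  op_hom_ext (one_smul R (0 : P.complex.X n ⟶ Y))

lemma homComplexOpHom_add {n : ℕ} (f g : P.complex.X n ⟶ Y) :
    P.homComplexOpHom (f + g) = P.homComplexOpHom f + P.homComplexOpHom g := by
  apply op_hom_ext
  change (1 : R) • (f + g) = (1 : R) • f + (1 : R) • g
  simp

lemma homComplexOpHom_surjective {n : ℕ} :
    Function.Surjective (P.homComplexOpHom (n := n) (Y := Y)) :=
  fun k ↦ ⟨k.unop.hom (1 : R), op_hom_ext (homComplexOpHom_apply ..)⟩

lemma homComplexOpHom_injective {n : ℕ} :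
    Function.Injective (P.homComplexOpHom (n := n) (Y := Y)) :=
  fun f g h ↦ by rw [← homComplexOpHom_apply P f, h, homComplexOpHom_apply]

/-- The class in `Ext` of a cocycle. -/
noncomputable def cocycleClass {n : ℕ} (f : P.complex.X n ⟶ Y)
    (hf : P.complex.d (n + 1) n ≫ f = 0) :
    ((Ext R (ModuleCat.{u} R) n).obj (op X)).obj Y :=
  ((P.opExtIso Y n).hom ≫ (P.homComplexOp Y).homologyDesc (P.homComplexOpHom f)
      (by rw [d_comp_homComplexOpHom, hf, homComplexOpHom_zero])).unop.hom (1 : R)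

lemma cocycleClass_surjective {n : ℕ} (a : ((Ext R (ModuleCat.{u} R) n).obj (op X)).obj Y) :
    ∃ (f : P.complex.X n ⟶ Y) (hf : P.complex.d (n + 1) n ≫ f = 0), P.cocycleClass f hf = a := by
  obtain ⟨k, hk, h⟩ := ChainComplex.exists_homologyDesc_eq (P.homComplexOp Y)
    ((P.opExtIso Y n).inv ≫ (ModuleCat.ofHom (LinearMap.toSpanSingleton R _ a)).op)
  obtain ⟨f, rfl⟩ := P.homComplexOpHom_surjective k
  refine ⟨f, P.homComplexOpHom_injective ?_, ?_⟩
  · rw [← d_comp_homComplexOpHom, hk, homComplexOpHom_zero]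
  · rw [cocycleClass, h, Iso.hom_inv_id_assoc]
    exact one_smul R a

lemma exists_of_cocycleClass_eq_zero {n : ℕ} (f : P.complex.X (n + 1) ⟶ Y)
    (hf : P.complex.d (n + 1 + 1) (n + 1) ≫ f = 0) (h : P.cocycleClass f hf = 0) :
    ∃ g : P.complex.X n ⟶ Y, P.complex.d (n + 1) n ≫ g = f := by
  have h0 : (P.opExtIso Y (n + 1)).hom ≫ (P.homComplexOp Y).homologyDesc (P.homComplexOpHom f)
      (by rw [d_comp_homComplexOpHom, hf, homComplexOpHom_zero]) = 0 := op_hom_ext h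
  rw [← Limits.comp_zero (f := (P.opExtIso Y (n + 1)).hom), cancel_epi] at h0
  obtain ⟨g, hg⟩ := ChainComplex.exists_of_homologyDesc_eq_zero _ _ _ h0
  obtain ⟨g, rfl⟩ := P.homComplexOpHom_surjective g
  exact ⟨g, P.homComplexOpHom_injective (by rw [← d_comp_homComplexOpHom, hg])⟩

lemma cocycleClass_add {n : ℕ} (f g : P.complex.X n ⟶ Y)
    (hf : P.complex.d (n + 1) n ≫ f = 0) (hg : P.complex.d (n + 1) n ≫ g = 0) :
    P.cocycleClass (f + g) (by simp [hf, hg]) = P.cocycleClass f hf + P.cocycleClass g hg := by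
  simp only [cocycleClass, homComplexOpHom_add]
  rw [ChainComplex.homologyDesc_add, Preadditive.comp_add]
  rfl

lemma homComplexOpHom_smul {n : ℕ} (r : R) (f : P.complex.X n ⟶ Y) :
    P.homComplexOpHom (r • f) =
      P.homComplexOpHom f ≫ (ModuleCat.ofHom (r • LinearMap.id : R →ₗ[R] R)).op := by
  apply op_hom_ext
  change (1 : R) • r • f = (r • (1 : R)) • f
  simp

lemma comp_smul_op_unop_apply_one {M : (ModuleCat.{u} R)ᵒᵖ} (k : M ⟶ op (ModuleCat.of R R))
    (r : R) :
    (k ≫ (ModuleCat.ofHom (r • LinearMap.id : R →ₗ[R] R)).op).unop.hom (1 : R) =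
      r • k.unop.hom (1 : R) :=
  LinearMap.map_smul k.unop.hom r (1 : R)

lemma cocycleClass_smul {n : ℕ} (r : R) (f : P.complex.X n ⟶ Y)
    (hf : P.complex.d (n + 1) n ≫ f = 0) :
    P.cocycleClass (r • f) (by simp [hf]) = r • P.cocycleClass f hf := by
  have key : (P.opExtIso Y n).hom ≫ (P.homComplexOp Y).homologyDesc (P.homComplexOpHom (r • f))
      (by rw [d_comp_homComplexOpHom, Linear.comp_smul, hf, smul_zero, homComplexOpHom_zero]) =
      ((P.opExtIso Y n).hom ≫ (P.homComplexOp Y).homologyDesc (P.homComplexOpHom f)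
        (by rw [d_comp_homComplexOpHom, hf, homComplexOpHom_zero])) ≫
        (ModuleCat.ofHom (r • LinearMap.id : R →ₗ[R] R)).op := by
    rw [Category.assoc, ChainComplex.homologyDesc_comp]
    simp only [homComplexOpHom_smul]
  exact congr($(key).unop.hom (1 : R)).trans (comp_smul_op_unop_apply_one _ r)

lemma map_cocycleClass {n : ℕ} {X' : ModuleCat.{u} R} {P : ProjectiveResolution X}
    {P' : ProjectiveResolution X'} {g : X' ⟶ X} (φ : Hom P' P g)
    (f : P.complex.X n ⟶ Y) (hf : P.complex.d (n + 1) n ≫ f = 0) :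
    (((Ext R (ModuleCat.{u} R) n).map g.op).app Y).hom (P.cocycleClass f hf) =
      P'.cocycleClass (φ.hom.f n ≫ f) (by simp [← φ.hom.comm_assoc, hf]) := by
  have h := isoLeftDerivedObj_hom_naturality g P' P φ.hom (by simpa using φ.hom_f_zero_comp_π_f_zero)
    ((linearYoneda R (ModuleCat.{u} R)).obj Y).rightOp n
  let ψ : P'.homComplexOp Y ⟶ P.homComplexOp Y :=
    (((linearYoneda R (ModuleCat.{u} R)).obj Y).rightOp.mapHomologicalComplex _).map φ.hom
  let e : op (((Ext R (ModuleCat.{u} R) n).obj (op X')).obj Y) ⟶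
    op (((Ext R (ModuleCat.{u} R) n).obj (op X)).obj Y) :=
    (((Ext R (ModuleCat.{u} R) n).map g.op).app Y).op
  replace h : e ≫ (P.opExtIso Y n).hom = (P'.opExtIso Y n).hom ≫
    HomologicalComplex.homologyMap ψ n := h
  have hψ : ψ.f n ≫ P.homComplexOpHom f = P'.homComplexOpHom (φ.hom.f n ≫ f) := by
    apply op_hom_ext
    change φ.hom.f n ≫ ((1 : R) • f) = (1 : R) • (φ.hom.f n ≫ f)
    simp
  have key : e ≫ (P.opExtIso Y n).hom ≫ (P.homComplexOp Y).homologyDesc (P.homComplexOpHom f)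
      (by rw [d_comp_homComplexOpHom, hf, homComplexOpHom_zero]) =
    (P'.opExtIso Y n).hom ≫ (P'.homComplexOp Y).homologyDesc (P'.homComplexOpHom (φ.hom.f n ≫ f))
      (by rw [d_comp_homComplexOpHom, ← φ.hom.comm_assoc, hf, Limits.comp_zero,
        homComplexOpHom_zero]) := by
    rw [reassoc_of% h, ChainComplex.homologyMap_comp_homologyDesc]
    simp only [hψ]
  exact congr($(key).unop.hom (1 : R))

lemma cocycleClass_map {n : ℕ} {Y' : ModuleCat.{u} R} (g : Y ⟶ Y')
    (f : P.complex.X n ⟶ Y) (hf : P.complex.d (n + 1) n ≫ f = 0) :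
    (((Ext R (ModuleCat.{u} R) n).obj (op X)).map g).hom (P.cocycleClass f hf) =
      P.cocycleClass (f ≫ g) (by simp [reassoc_of% hf]) := by
  let α := NatTrans.rightOp ((linearYoneda R (ModuleCat.{u} R)).map g)
  have h := leftDerived_app_eq α P n
  let ψ : P.homComplexOp Y' ⟶ P.homComplexOp Y :=
    (NatTrans.mapHomologicalComplex α _).app P.complex
  let e : op (((Ext R (ModuleCat.{u} R) n).obj (op X)).obj Y') ⟶
    op (((Ext R (ModuleCat.{u} R) n).obj (op X)).obj Y) :=
    (((Ext R (ModuleCat.{u} R) n).obj (op X)).map g).op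
  replace h : e = (P.opExtIso Y' n).hom ≫
    HomologicalComplex.homologyMap ψ n ≫ (P.opExtIso Y n).inv := h
  have hψ : ψ.f n ≫ P.homComplexOpHom f = P.homComplexOpHom (f ≫ g) := by
    apply op_hom_ext
    change ((1 : R) • f) ≫ g = (1 : R) • (f ≫ g)
    simp
  have key : e ≫ (P.opExtIso Y n).hom ≫ (P.homComplexOp Y).homologyDesc (P.homComplexOpHom f)
      (by rw [d_comp_homComplexOpHom, hf, homComplexOpHom_zero]) =
    (P.opExtIso Y' n).hom ≫ (P.homComplexOp Y').homologyDesc (P.homComplexOpHom (f ≫ g))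
      (by rw [d_comp_homComplexOpHom, reassoc_of% hf, Limits.zero_comp,
        homComplexOpHom_zero]) := by
    rw [h, Category.assoc, Category.assoc, Iso.inv_hom_id_assoc,
      ChainComplex.homologyMap_comp_homologyDesc]
    simp only [hψ]
  exact congr($(key).unop.hom (1 : R))

lemma cocycleClass_d_comp {n : ℕ} (g : P.complex.X n ⟶ Y) :
    P.cocycleClass (P.complex.d (n + 1) n ≫ g) (by simp) = 0 := by
  have key : (P.opExtIso Y (n + 1)).hom ≫ (P.homComplexOp Y).homologyDesc
      (P.homComplexOpHom (P.complex.d (n + 1) n ≫ g))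
      (by rw [d_comp_homComplexOpHom, HomologicalComplex.d_comp_d_assoc, Limits.zero_comp,
        homComplexOpHom_zero]) = 0 := by
    simp only [← d_comp_homComplexOpHom]
    rw [ChainComplex.homologyDesc_d_comp, Limits.comp_zero]
  exact congr($(key).unop.hom (1 : R))

lemma cocycleClass_sub {n : ℕ} (f g : P.complex.X n ⟶ Y)
    (hf : P.complex.d (n + 1) n ≫ f = 0) (hg : P.complex.d (n + 1) n ≫ g = 0) :
    P.cocycleClass (f - g) (by simp [hf, hg]) = P.cocycleClass f hf - P.cocycleClass g hg := by
  rw [eq_sub_iff_add_eq, ← cocycleClass_add]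
  simp only [sub_add_cancel]

lemma extMk_eq_of_cocycleClass_eq {n : ℕ} (f g : P.complex.X (n + 1) ⟶ Y)
    (hf : P.complex.d (n + 1 + 1) (n + 1) ≫ f = 0) (hg : P.complex.d (n + 1 + 1) (n + 1) ≫ g = 0)
    (h : P.cocycleClass f hf = P.cocycleClass g hg) :
    P.extMk f _ rfl hf = P.extMk g _ rfl hg := by
  rw [← sub_eq_zero, sub_extMk, extMk_eq_zero_iff _ _ _ _ _ n rfl]
  refine P.exists_of_cocycleClass_eq_zero _ (by simp [hf, hg]) ?_
  rw [cocycleClass_sub _ _ _ hf hg, h, sub_self]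

lemma smul_extMk {n : ℕ} (r : R) (f : P.complex.X n ⟶ Y) (hf : P.complex.d (n + 1) n ≫ f = 0) :
    r • P.extMk f _ rfl hf = P.extMk (r • f) _ rfl (by simp [hf]) := by
  rw [Abelian.Ext.smul_eq_comp_mk₀, extMk_comp_mk₀]
  simp

end CategoryTheory.ProjectiveResolution

namespace CategoryTheory.ProjectiveResolution

variable {R : Type u} [CommRing R]

/-- The comparison map from the left derived functors of `Hom(-, Y)` to `Abelian.Ext` in positive
degrees. -/
noncomputable def extToAbelianExt (X Y : ModuleCat.{u} R) (n : ℕ) :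
    ((Ext R (ModuleCat.{u} R) (n + 1)).obj (op X)).obj Y →ₗ[R] Abelian.Ext X Y (n + 1) where
  toFun a := (projectiveResolution X).extMk
    ((projectiveResolution X).cocycleClass_surjective a).choose _ rfl
    ((projectiveResolution X).cocycleClass_surjective a).choose_spec.choose
  map_add' a b := by
    rw [ProjectiveResolution.add_extMk]
    apply ProjectiveResolution.extMk_eq_of_cocycleClass_eq
    rw [ProjectiveResolution.cocycleClass_add _ _ _
      (((projectiveResolution X).cocycleClass_surjective a).choose_spec.choose)
      (((projectiveResolution X).cocycleClass_surjective b).choose_spec.choose)]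
    rw [((projectiveResolution X).cocycleClass_surjective a).choose_spec.choose_spec,
      ((projectiveResolution X).cocycleClass_surjective b).choose_spec.choose_spec,
      ((projectiveResolution X).cocycleClass_surjective (a + b)).choose_spec.choose_spec]
  map_smul' r a := by
    rw [RingHom.id_apply, ProjectiveResolution.smul_extMk]
    apply ProjectiveResolution.extMk_eq_of_cocycleClass_eq
    rw [ProjectiveResolution.cocycleClass_smul _ _ _
      (((projectiveResolution X).cocycleClass_surjective a).choose_spec.choose)]
    rw [((projectiveResolution X).cocycleClass_surjective a).choose_spec.choose_spec,
      ((projectiveResolution X).cocycleClass_surjective (r • a)).choose_spec.choose_spec]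

lemma extToAbelianExt_cocycleClass {X Y : ModuleCat.{u} R} {n : ℕ}
    (f : (projectiveResolution X).complex.X (n + 1) ⟶ Y)
    (hf : (projectiveResolution X).complex.d (n + 1 + 1) (n + 1) ≫ f = 0) :
    extToAbelianExt X Y n ((projectiveResolution X).cocycleClass f hf) =
      (projectiveResolution X).extMk f _ rfl hf :=
  ProjectiveResolution.extMk_eq_of_cocycleClass_eq _ _ _ _ _
    ((projectiveResolution X).cocycleClass_surjective _).choose_spec.choose_spec

lemma extToAbelianExt_bijective (X Y : ModuleCat.{u} R) (n : ℕ) :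
    Function.Bijective (extToAbelianExt X Y n) := by
  constructor
  · rw [injective_iff_map_eq_zero]
    intro a ha
    obtain ⟨f, hf, rfl⟩ := (projectiveResolution X).cocycleClass_surjective a
    rw [extToAbelianExt_cocycleClass, ProjectiveResolution.extMk_eq_zero_iff _ _ _ _ _ n rfl] at ha
    obtain ⟨g, rfl⟩ := ha
    exact ProjectiveResolution.cocycleClass_d_comp _ g
  · intro a
    obtain ⟨f, hf, rfl⟩ := (projectiveResolution X).extMk_surjective a _ rfl
    exact ⟨_, extToAbelianExt_cocycleClass f hf⟩

/-- The left derived functors of `Hom(-, Y)` agree with `Abelian.Ext` in positive degrees. -/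
noncomputable def extEquivAbelianExt (X Y : ModuleCat.{u} R) (n : ℕ) :
    ((Ext R (ModuleCat.{u} R) (n + 1)).obj (op X)).obj Y ≃ₗ[R] Abelian.Ext X Y (n + 1) :=
  LinearEquiv.ofBijective _ (extToAbelianExt_bijective X Y n)

lemma map_extEquivAbelianExt_symm {X X' Y : ModuleCat.{u} R} (g : X' ⟶ X) {n : ℕ}
    (a : Abelian.Ext X Y (n + 1)) :
    (((Ext R (ModuleCat.{u} R) (n + 1)).map g.op).app Y).hom ((extEquivAbelianExt X Y n).symm a) =
      (extEquivAbelianExt X' Y n).symm ((Abelian.Ext.mk₀ g).comp a (zero_add _)) := by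
  obtain ⟨a, rfl⟩ := (extEquivAbelianExt X Y n).surjective a
  obtain ⟨f, hf, rfl⟩ := (projectiveResolution X).cocycleClass_surjective a
  rw [LinearEquiv.symm_apply_apply, LinearEquiv.eq_symm_apply]
  let φ : ProjectiveResolution.Hom (projectiveResolution X') (projectiveResolution X) g :=
    ⟨lift g _ _, (lift_commutes_zero g _ _).trans (by simp)⟩
  rw [ProjectiveResolution.map_cocycleClass φ]
  refine (extToAbelianExt_cocycleClass _ _).trans ?_
  refine Eq.trans ?_ (congr((Abelian.Ext.mk₀ g).comp $(extToAbelianExt_cocycleClass f hf)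
    (zero_add _)).symm)
  rw [ProjectiveResolution.mk₀_comp_extMk _ _ _ _ φ]

lemma extEquivAbelianExt_symm_map {X Y Y' : ModuleCat.{u} R} (g : Y ⟶ Y') {n : ℕ}
    (a : Abelian.Ext X Y (n + 1)) :
    (((Ext R (ModuleCat.{u} R) (n + 1)).obj (op X)).map g).hom
        ((extEquivAbelianExt X Y n).symm a) =
      (extEquivAbelianExt X Y' n).symm (a.comp (Abelian.Ext.mk₀ g) (add_zero _)) := by
  obtain ⟨a, rfl⟩ := (extEquivAbelianExt X Y n).surjective a
  obtain ⟨f, hf, rfl⟩ := (projectiveResolution X).cocycleClass_surjective a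
  rw [LinearEquiv.symm_apply_apply, LinearEquiv.eq_symm_apply,
    ProjectiveResolution.cocycleClass_map]
  refine (extToAbelianExt_cocycleClass _ _).trans ?_
  refine Eq.trans ?_ (congr(($(extToAbelianExt_cocycleClass f hf)).comp (Abelian.Ext.mk₀ g)
    (add_zero _)).symm)
  rw [ProjectiveResolution.extMk_comp_mk₀]

end CategoryTheory.ProjectiveResolution

section

open Limits CategoryTheory.ProjectiveResolution

variable {R : Type u} [CommRing R]

namespace Ideal

/-- The projection `R ⧸ J ⟶ R ⧸ K`, for ideals `J ≤ K`. -/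
abbrev quotientHom {J K : Ideal R} (h : J ≤ K) : ModuleCat.of R (R ⧸ J) ⟶ ModuleCat.of R (R ⧸ K) :=
  ModuleCat.ofHom (Submodule.mapQ J K LinearMap.id h)

lemma quotientHom_comp {I J K : Ideal R} (h : I ≤ J) (h' : J ≤ K) :
    quotientHom h ≫ quotientHom h' = quotientHom (h.trans h') := by
  ext
  rfl

end Ideal

namespace localCohomology

open Ideal (quotientHom quotientHom_comp)

variable (𝔞 : Ideal R) (M : ModuleCat.{u} R) (i : ℕ)

/-- The canonical map from `Ext (R ⧸ 𝔞 ^ n) M` to local cohomology in positive degrees. -/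
noncomputable def ofExt (n : ℕ) :
    Abelian.Ext (ModuleCat.of R (R ⧸ 𝔞 ^ n)) M (i + 1) →ₗ[R]
      (localCohomology 𝔞 (i + 1)).obj M :=
  ((colimit.ι (diagram (idealPowersDiagram 𝔞) (i + 1)) (op (op n))).app M).hom ∘ₗ
    (extEquivAbelianExt (ModuleCat.of R (R ⧸ 𝔞 ^ n)) M i).symm.toLinearMap

variable {𝔞 M i}

lemma ofExt_quotientHom_comp {m n : ℕ} (h : n ≤ m)
    (a : Abelian.Ext (ModuleCat.of R (R ⧸ 𝔞 ^ n)) M (i + 1)) :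
    ofExt 𝔞 M i m ((Abelian.Ext.mk₀ (quotientHom (Ideal.pow_le_pow_right h))).comp a
      (zero_add _)) = ofExt 𝔞 M i n a := by
  let w : (op (op n) : (ℕᵒᵖ)ᵒᵖ) ⟶ op (op m) := (homOfLE h).op.op
  have h1 := colimit.w (diagram (idealPowersDiagram 𝔞) (i + 1)) w
  have h2 := congr(($h1).app M)
  refine Eq.trans ?_ congr(($h2).hom ((extEquivAbelianExt (ModuleCat.of R (R ⧸ 𝔞 ^ n)) M i).symm a))
  exact congrArg ((colimit.ι (diagram (idealPowersDiagram 𝔞) (i + 1)) (op (op m))).app M).hom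
    (map_extEquivAbelianExt_symm (quotientHom (Ideal.pow_le_pow_right h)) a).symm

lemma map_ofExt {M' : ModuleCat.{u} R} (f : M ⟶ M') {n : ℕ}
    (a : Abelian.Ext (ModuleCat.of R (R ⧸ 𝔞 ^ n)) M (i + 1)) :
    ((localCohomology 𝔞 (i + 1)).map f).hom (ofExt 𝔞 M i n a) =
      ofExt 𝔞 M' i n (a.comp (Abelian.Ext.mk₀ f) (add_zero _)) := by
  have h := (colimit.ι (diagram (idealPowersDiagram 𝔞) (i + 1)) (op (op n))).naturality f
  refine Eq.trans congr(($h).hom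
    ((extEquivAbelianExt (ModuleCat.of R (R ⧸ 𝔞 ^ n)) M i).symm a)).symm ?_
  exact congrArg ((colimit.ι (diagram (idealPowersDiagram 𝔞) (i + 1)) (op (op n))).app M').hom
    (extEquivAbelianExt_symm_map f a)

instance preservesColimit_forget_of_nat (F : (ℕᵒᵖ)ᵒᵖ ⥤ ModuleCat.{u} R) :
    PreservesColimit F (forget (ModuleCat.{u} R)) := by
  have : IsFiltered (ℕᵒᵖ)ᵒᵖ := isFiltered_op_of_isCofiltered _
  have : PreservesFilteredColimitsOfSize.{0, 0} (forget (ModuleCat.{u} R)) :=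
    preservesSmallestFilteredColimits_of_preservesFilteredColimits.{u, u} _
  infer_instance

variable (𝔞 M i) in
/-- Local cohomology of `M` as a colimit of modules. -/
noncomputable def isColimitEvaluation :
    IsColimit (((evaluation _ _).obj M).mapCocone
      (colimit.cocone (diagram (idealPowersDiagram 𝔞) i))) :=
  isColimitOfPreserves _ (colimit.isColimit _)

lemma exists_ofExt_eq (x : (localCohomology 𝔞 (i + 1)).obj M) :
    ∃ n a, ofExt 𝔞 M i n a = x := by
  obtain ⟨n, a, h⟩ := Concrete.isColimit_exists_rep _ (isColimitEvaluation 𝔞 M (i + 1)) x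
  refine ⟨n.unop.unop, extEquivAbelianExt _ _ _ a, ?_⟩
  rw [← h]
  exact congrArg ((colimit.ι (diagram (idealPowersDiagram 𝔞) (i + 1)) n).app M).hom
    (LinearEquiv.symm_apply_apply _ _)

lemma exists_of_ofExt_eq_zero {n : ℕ}
    (a : Abelian.Ext (ModuleCat.of R (R ⧸ 𝔞 ^ n)) M (i + 1)) (ha : ofExt 𝔞 M i n a = 0) :
    ∃ (m : ℕ) (h : n ≤ m), (Abelian.Ext.mk₀ (quotientHom (Ideal.pow_le_pow_right h))).comp a
      (zero_add _) = 0 := by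
  have : IsFiltered (ℕᵒᵖ)ᵒᵖ := isFiltered_op_of_isCofiltered _
  obtain ⟨m, f, g, h⟩ := Concrete.isColimit_exists_of_rep_eq _ (isColimitEvaluation 𝔞 M (i + 1))
    (i := op (op n)) (j := op (op n)) ((extEquivAbelianExt _ M i).symm a) 0
    (ha.trans (map_zero ((colimit.ι (diagram (idealPowersDiagram 𝔞) (i + 1))
      (op (op n))).app M).hom).symm)
  refine ⟨m.unop.unop, leOfHom f.unop.unop, ?_⟩
  rw [← (extEquivAbelianExt _ M i).symm.map_eq_zero_iff, ← map_extEquivAbelianExt_symm]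
  refine Eq.trans ?_ (h.trans (map_zero _))
  rfl

end localCohomology

lemma isArtinian_of_ker_le_range_s15 {A B C : Type*} [AddCommGroup A] [AddCommGroup B] [AddCommGroup C]
    [Module R A] [Module R B] [Module R C] [IsArtinian R A] [IsArtinian R C]
    (f : A →ₗ[R] B) (g : B →ₗ[R] C) (h : g.ker ≤ f.range) : IsArtinian R B := by
  have : IsArtinian R g.ker := isArtinian_of_le h
  exact isArtinian_of_range_eq_ker g.ker.subtype g g.ker.range_subtype

namespace localCohomology

open Ideal (quotientHom quotientHom_comp)

variable {𝔞 : Ideal R} {M : ModuleCat.{u} R} {i : ℕ}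

lemma exists_quotientHom_comp_eq {m n : ℕ} {a : Abelian.Ext (ModuleCat.of R (R ⧸ 𝔞 ^ m)) M (i + 1)}
    {b : Abelian.Ext (ModuleCat.of R (R ⧸ 𝔞 ^ n)) M (i + 1)}
    (h : ofExt 𝔞 M i m a = ofExt 𝔞 M i n b) :
    ∃ (k : ℕ) (hm : m ≤ k) (hn : n ≤ k),
      (Abelian.Ext.mk₀ (quotientHom (Ideal.pow_le_pow_right hm))).comp a (zero_add _) =
      (Abelian.Ext.mk₀ (quotientHom (Ideal.pow_le_pow_right hn))).comp b (zero_add _) := by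
  rw [← ofExt_quotientHom_comp (le_max_left m n), ← ofExt_quotientHom_comp (le_max_right m n),
    ← sub_eq_zero, ← map_sub] at h
  obtain ⟨k, hk, h⟩ := exists_of_ofExt_eq_zero _ h
  refine ⟨k, (le_max_left m n).trans hk, (le_max_right m n).trans hk, ?_⟩
  rwa [sub_eq_add_neg, Abelian.Ext.comp_add, Abelian.Ext.comp_neg, ← sub_eq_add_neg, sub_eq_zero,
    Abelian.Ext.mk₀_comp_mk₀_assoc,
    Abelian.Ext.mk₀_comp_mk₀_assoc, quotientHom_comp, quotientHom_comp] at h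

/-- Compatible linear maps on the modules `Ext (R ⧸ 𝔞 ^ n) M` induce a linear map on local
cohomology. -/
lemma exists_linearMap_ofExt {P : Type*} [AddCommGroup P] [Module R P]
    (θ : ∀ n, Abelian.Ext (ModuleCat.of R (R ⧸ 𝔞 ^ n)) M (i + 1) →ₗ[R] P)
    (hθ : ∀ {m n : ℕ} (h : n ≤ m) (a : Abelian.Ext (ModuleCat.of R (R ⧸ 𝔞 ^ n)) M (i + 1)),
      θ m ((Abelian.Ext.mk₀ (quotientHom (Ideal.pow_le_pow_right h))).comp a (zero_add _)) =
        θ n a) :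
    ∃ d : (localCohomology 𝔞 (i + 1)).obj M →ₗ[R] P, ∀ n a, d (ofExt 𝔞 M i n a) = θ n a := by
  choose N α hα using exists_ofExt_eq (𝔞 := 𝔞) (M := M) (i := i)
  have key : ∀ n a, θ (N (ofExt 𝔞 M i n a)) (α (ofExt 𝔞 M i n a)) = θ n a := fun n a ↦ by
    obtain ⟨k, h1, h2, h⟩ := exists_quotientHom_comp_eq (hα (ofExt 𝔞 M i n a))
    rw [← hθ h1, h, hθ h2]
  refine ⟨{ toFun := fun x ↦ θ (N x) (α x), map_add' := fun x y ↦ ?_, map_smul' := fun r x ↦ ?_ },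
    key⟩
  · obtain ⟨m, a, rfl⟩ := exists_ofExt_eq x
    obtain ⟨n, b, rfl⟩ := exists_ofExt_eq y
    rw [← ofExt_quotientHom_comp (le_max_left m n), ← ofExt_quotientHom_comp (le_max_right m n) b,
      ← map_add, key, key, key, map_add]
  · obtain ⟨m, a, rfl⟩ := exists_ofExt_eq x
    rw [← map_smul, key, key, map_smul, RingHom.id_apply]

variable {S : ShortComplex (ModuleCat.{u} R)} (hS : S.ShortExact)
include hS

lemma ker_map_g_le_range_map_f :
    ((localCohomology 𝔞 (i + 1)).map S.g).hom.ker ≤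
      ((localCohomology 𝔞 (i + 1)).map S.f).hom.range := by
  intro x hx
  obtain ⟨n, a, rfl⟩ := exists_ofExt_eq x
  rw [LinearMap.mem_ker, map_ofExt] at hx
  obtain ⟨m, h, h0⟩ := exists_of_ofExt_eq_zero _ hx
  rw [← Abelian.Ext.comp_assoc_of_third_deg_zero] at h0
  obtain ⟨b, hb⟩ := Abelian.Ext.covariant_sequence_exact₂ _ hS _ h0
  exact ⟨ofExt 𝔞 S.X₁ i m b, by rw [map_ofExt, hb, ofExt_quotientHom_comp h]⟩

lemma exists_ker_le_range_map_g :
    ∃ δ : (localCohomology 𝔞 (i + 1)).obj S.X₃ →ₗ[R] (localCohomology 𝔞 (i + 1 + 1)).obj S.X₁,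
      δ.ker ≤ ((localCohomology 𝔞 (i + 1)).map S.g).hom.range := by
  have hcomp {m n : ℕ} (h : n ≤ m)
      (a : Abelian.Ext (ModuleCat.of R (R ⧸ 𝔞 ^ n)) S.X₃ (i + 1)) :
      ((Abelian.Ext.mk₀ (quotientHom (Ideal.pow_le_pow_right h))).comp a (zero_add _)).comp
        hS.extClass rfl =
      (Abelian.Ext.mk₀ (quotientHom (Ideal.pow_le_pow_right h))).comp
        (a.comp hS.extClass rfl) (zero_add _) :=
    Abelian.Ext.comp_assoc _ _ _ _ _ (by lia)
  let θ (n : ℕ) : Abelian.Ext (ModuleCat.of R (R ⧸ 𝔞 ^ n)) S.X₃ (i + 1) →ₗ[R]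
      (localCohomology 𝔞 (i + 1 + 1)).obj S.X₁ :=
    ofExt 𝔞 S.X₁ (i + 1) n ∘ₗ hS.extClass.postcompOfLinear R _ rfl
  have hθ (n : ℕ) (a : Abelian.Ext (ModuleCat.of R (R ⧸ 𝔞 ^ n)) S.X₃ (i + 1)) :
      θ n a = ofExt 𝔞 S.X₁ (i + 1) n (a.comp hS.extClass rfl) := rfl
  obtain ⟨δ, hδ⟩ := exists_linearMap_ofExt θ fun h a ↦ by
    rw [hθ, hθ, hcomp h, ofExt_quotientHom_comp h]
  refine ⟨δ, fun x hx ↦ ?_⟩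
  obtain ⟨n, a, rfl⟩ := exists_ofExt_eq x
  rw [LinearMap.mem_ker, hδ, hθ] at hx
  obtain ⟨m, h, h0⟩ := exists_of_ofExt_eq_zero _ hx
  rw [← hcomp h] at h0
  obtain ⟨b, hb⟩ := Abelian.Ext.covariant_sequence_exact₃ _ hS _ rfl h0
  exact ⟨ofExt 𝔞 S.X₂ i m b, by rw [map_ofExt, hb, ofExt_quotientHom_comp h]⟩

lemma isArtinian_X₂ [IsArtinian R ((localCohomology 𝔞 (i + 1)).obj S.X₁)]
    [IsArtinian R ((localCohomology 𝔞 (i + 1)).obj S.X₃)] :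
    IsArtinian R ((localCohomology 𝔞 (i + 1)).obj S.X₂) :=
  isArtinian_of_ker_le_range_s15 _ _ (ker_map_g_le_range_map_f hS)

lemma isArtinian_X₃ [IsArtinian R ((localCohomology 𝔞 (i + 1)).obj S.X₂)]
    [IsArtinian R ((localCohomology 𝔞 (i + 1 + 1)).obj S.X₁)] :
    IsArtinian R ((localCohomology 𝔞 (i + 1)).obj S.X₃) := by
  obtain ⟨δ, hδ⟩ := exists_ker_le_range_map_g (𝔞 := 𝔞) (i := i) hS
  exact isArtinian_of_ker_le_range_s15 _ _ hδ

end localCohomology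

namespace Ideal

/-- The colon ideal of elements that `r` multiplies into `J`. -/
abbrev mulComap (J : Ideal R) (r : R) : Ideal R := Submodule.comap (LinearMap.mulLeft R r) J

/-- The short complex `0 ⟶ R ⧸ (J : r) ⟶ R ⧸ J ⟶ R ⧸ (J + (r)) ⟶ 0`. -/
abbrev colonShortComplex (J : Ideal R) (r : R) : ShortComplex (ModuleCat.{u} R) where
  X₁ := ModuleCat.of R (R ⧸ J.mulComap r)
  X₂ := ModuleCat.of R (R ⧸ J)
  X₃ := ModuleCat.of R (R ⧸ J ⊔ span {r})
  f := ModuleCat.ofHom (Submodule.mapQ (J.mulComap r) J (LinearMap.mulLeft R r) le_rfl)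
  g := quotientHom le_sup_left
  zero := by
    ext
    exact (Submodule.Quotient.mk_eq_zero _).mpr
      (Ideal.mul_mem_right _ _ (mem_sup_right (mem_span_singleton_self r)))

lemma colonShortComplex_shortExact (J : Ideal R) (r : R) : (J.colonShortComplex r).ShortExact := by
  refine ModuleCat.shortComplex_shortExact _ ?_ ?_ ?_
  · intro y
    obtain ⟨y, rfl⟩ := Submodule.Quotient.mk_surjective _ y
    constructor
    · intro h
      obtain ⟨j, hj, s, hs, rfl⟩ := Submodule.mem_sup.mp ((Submodule.Quotient.mk_eq_zero _).mp h)
      obtain ⟨s, rfl⟩ := mem_span_singleton'.mp hs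
      refine ⟨Submodule.Quotient.mk s, (Submodule.Quotient.eq _).mpr ?_⟩
      simpa [mul_comm] using hj
    · rintro ⟨s, hs⟩
      obtain ⟨s, rfl⟩ := Submodule.Quotient.mk_surjective _ s
      rw [← hs]
      exact (Submodule.Quotient.mk_eq_zero _).mpr
        (Ideal.mul_mem_right _ _ (mem_sup_right (mem_span_singleton_self r)))
  · refine (injective_iff_map_eq_zero _).mpr fun y h ↦ ?_
    obtain ⟨y, rfl⟩ := Submodule.Quotient.mk_surjective _ y
    exact (Submodule.Quotient.mk_eq_zero _).mpr
      ((Submodule.Quotient.mk_eq_zero J (x := r * y)).mp h :)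
  · intro y
    obtain ⟨y, rfl⟩ := Submodule.Quotient.mk_surjective _ y
    exact ⟨Submodule.Quotient.mk y, rfl⟩

/-- Morphisms of the short complexes `0 ⟶ R ⧸ (J : r) ⟶ R ⧸ J ⟶ R ⧸ (J + (r)) ⟶ 0`. -/
abbrev colonShortComplexHom {J K : Ideal R} (h : J ≤ K) (r s : R) :
    J.colonShortComplex (r * s) ⟶ K.colonShortComplex r where
  τ₁ := ModuleCat.ofHom (Submodule.mapQ (J.mulComap (r * s)) (K.mulComap r)
    (LinearMap.mulLeft R s) fun y hy ↦ h (by simpa [mul_assoc] using hy))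
  τ₂ := quotientHom h
  τ₃ := quotientHom (sup_le_sup h
    (span_singleton_le_span_singleton.mpr (Dvd.intro s rfl)))
  comm₁₂ := by
    ext
    exact (congrArg (Submodule.Quotient.mk (p := K)) (mul_assoc r s 1)).symm
  comm₂₃ := by
    ext
    rfl

lemma exists_mulComap_mul_pow_le [IsNoetherianRing R] (J : Ideal R) (x : R) (n : ℕ) :
    ∃ k, J.mulComap (x ^ n * x ^ k) ≤ J.mulComap (x ^ k) := by
  obtain ⟨k, hk⟩ := monotone_stabilizes_iff_noetherian.mpr ‹IsNoetherianRing R›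
    ⟨fun k ↦ J.mulComap (x ^ k), monotone_nat_of_le_succ fun k y hy ↦ by
      have := J.mul_mem_left x hy
      simpa [pow_succ', mul_assoc] using this⟩
  refine ⟨k, ?_⟩
  have := hk (n + k) (by lia)
  simp only [OrderHom.coe_mk] at this
  rw [← pow_add, this]

end Ideal

namespace localCohomology

open Ideal

/-- Classes in `Ext (R ⧸ J) M` of degree greater than `r` vanish after restriction, for ideals `J`
containing powers of `𝔟`. -/
def ExtVanishesAbove (𝔟 : Ideal R) (r : ℕ) : Prop :=
  ∀ ⦃i : ℕ⦄, r < i → ∀ (M : ModuleCat.{u} R) (J : Ideal R), (∃ n, 𝔟 ^ n ≤ J) →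
    ∀ a : Abelian.Ext (ModuleCat.of R (R ⧸ J)) M i, ∃ (K : Ideal R) (h : K ≤ J),
      (∃ n, 𝔟 ^ n ≤ K) ∧ (Abelian.Ext.mk₀ (quotientHom h)).comp a (zero_add _) = 0

lemma extVanishesAbove_bot : ExtVanishesAbove (⊥ : Ideal R) 0 := by
  intro i hi M J _ a
  refine ⟨⊥, bot_le, ⟨1, by simp⟩, ?_⟩
  obtain ⟨i, rfl⟩ := Nat.exists_eq_succ_of_ne_zero hi.ne'
  have : Module.Projective R (R ⧸ (⊥ : Ideal R)) :=
    Module.Projective.of_equiv (Submodule.quotEquivOfEqBot ⊥ rfl).symm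
  have : Projective (ModuleCat.of R (R ⧸ (⊥ : Ideal R))) :=
    ModuleCat.projective_of_categoryTheory_projective _
  exact Abelian.Ext.eq_zero_of_projective _

lemma ExtVanishesAbove.sup_span [IsNoetherianRing R] {𝔟 : Ideal R} {r : ℕ}
    (hb : ExtVanishesAbove 𝔟 r) (x : R) :
    ExtVanishesAbove (𝔟 ⊔ span {x}) (r + 1) := by
  rintro i hi M J ⟨n, hn⟩ a
  obtain ⟨J₁, hJ₁, ⟨n₁, hn₁⟩, h₁⟩ := hb (by lia) M J
    ⟨n, (pow_right_mono le_sup_left n).trans hn⟩ a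
  have hx : span {x ^ n} ≤ J := by
    rw [← span_singleton_pow]
    exact (pow_right_mono le_sup_right n).trans hn
  have h₂ : (Abelian.Ext.mk₀ (J₁.colonShortComplex (x ^ n)).g).comp
      ((Abelian.Ext.mk₀ (quotientHom (sup_le hJ₁ hx))).comp a (zero_add _)) (zero_add _) = 0 := by
    rw [Abelian.Ext.mk₀_comp_mk₀_assoc, quotientHom_comp, h₁]
  obtain ⟨i, rfl⟩ := Nat.exists_eq_add_of_lt (Nat.zero_lt_of_lt hi)
  obtain ⟨c, hc⟩ := Abelian.Ext.contravariant_sequence_exact₃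
    (J₁.colonShortComplex_shortExact (x ^ n)) M _ h₂ (n₀ := i) (by lia)
  obtain ⟨J₂, hJ₂, ⟨n₂, hn₂⟩, h₃⟩ := hb (by lia) M (J₁.mulComap (x ^ n))
    ⟨n₁, hn₁.trans fun y hy ↦ J₁.mul_mem_left _ hy⟩ c
  obtain ⟨k, hk⟩ := (J₁ ⊓ J₂).exists_mulComap_mul_pow_le x n
  let φ := colonShortComplexHom (J := J₁ ⊓ J₂) (K := J₁) inf_le_left (x ^ n) (x ^ k)
  let μ : ModuleCat.of R (R ⧸ (J₁ ⊓ J₂).mulComap (x ^ n * x ^ k)) ⟶ ModuleCat.of R (R ⧸ J₂) :=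
    ModuleCat.ofHom (Submodule.mapQ _ J₂ (LinearMap.mulLeft R (x ^ k)) fun y hy ↦ (hk hy).2)
  have hφ : φ.τ₁ = μ ≫ quotientHom hJ₂ := by
    ext
    rfl
  have h₄ : (Abelian.Ext.mk₀ φ.τ₃).comp
      ((Abelian.Ext.mk₀ (quotientHom (sup_le hJ₁ hx))).comp a (zero_add _)) (zero_add _) = 0 := by
    rw [← hc, ← Abelian.Ext.comp_assoc _ _ _ (zero_add 1) _ (by lia),
      ← ShortComplex.ShortExact.extClass_naturality ((J₁ ⊓ J₂).colonShortComplex_shortExact _),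
      Abelian.Ext.comp_assoc _ _ _ (add_zero 1) (zero_add _) (by lia), hφ,
      ← Abelian.Ext.mk₀_comp_mk₀_assoc, h₃, Abelian.Ext.comp_zero, Abelian.Ext.comp_zero]
  rw [Abelian.Ext.mk₀_comp_mk₀_assoc, quotientHom_comp] at h₄
  refine ⟨(J₁ ⊓ J₂) ⊔ span {x ^ n * x ^ k}, _, ⟨max n₁ n₂ + (n + k), ?_⟩, h₄⟩
  refine (sup_pow_add_le_pow_sup_pow ..).trans (sup_le_sup (le_inf ?_ ?_) ?_)
  · exact (pow_le_pow_right (le_max_left ..)).trans hn₁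
  · exact (pow_le_pow_right (le_max_right ..)).trans hn₂
  · rw [span_singleton_pow, pow_add]

lemma exists_extVanishesAbove [IsNoetherianRing R] (𝔞 : Ideal R) :
    ∃ r, ExtVanishesAbove 𝔞 r := by
  classical
  obtain ⟨s, rfl⟩ := IsNoetherian.noetherian 𝔞
  induction s using Finset.induction_on with
  | empty => exact ⟨0, by simpa using extVanishesAbove_bot⟩
  | insert x s _ ih =>
    obtain ⟨r, hr⟩ := ih
    refine ⟨r + 1, ?_⟩
    rw [Finset.coe_insert, Submodule.span_insert, sup_comm]
    exact hr.sup_span x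

lemma exists_forall_subsingleton [IsNoetherianRing R] (𝔞 : Ideal R) :
    ∃ r, ∀ i, r < i → ∀ M : ModuleCat.{u} R, Subsingleton ((localCohomology 𝔞 i).obj M) := by
  obtain ⟨r, hr⟩ := exists_extVanishesAbove 𝔞
  refine ⟨r, fun i hi M ↦ ?_⟩
  obtain ⟨i, rfl⟩ := Nat.exists_eq_succ_of_ne_zero (Nat.ne_zero_of_lt hi)
  refine subsingleton_of_forall_eq 0 fun y ↦ ?_
  obtain ⟨n, a, rfl⟩ := exists_ofExt_eq y
  obtain ⟨K, hK, ⟨m, hm⟩, h⟩ := hr hi M (𝔞 ^ n) ⟨n, le_rfl⟩ a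
  rw [← ofExt_quotientHom_comp (le_max_left n m), ← quotientHom_comp
    ((pow_le_pow_right (le_max_right n m)).trans hm) hK, ← Abelian.Ext.mk₀_comp_mk₀_assoc, h,
    Abelian.Ext.comp_zero, map_zero]

end localCohomology

open scoped nonZeroDivisors in
lemma Module.exists_linearMap_quotient_ne_zero {L : Type*} [AddCommGroup L] [Module R L]
    [Module.Finite R L] {p : PrimeSpectrum R} (hp : p ∈ Module.support R L) :
    ∃ f : L →ₗ[R] R ⧸ p.asIdeal, f ≠ 0 := by
  classical
  let K := p.asIdeal.ResidueField
  have : Nontrivial (TensorProduct R K L) :=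
    (Module.mem_support_iff_nontrivial_residueField_tensorProduct p).mp hp
  obtain ⟨v, hv⟩ := exists_ne (0 : TensorProduct R K L)
  obtain ⟨φ, hφ⟩ := not_forall.mp ((Module.forall_dual_apply_eq_zero_iff K v).not.mpr hv)
  let ψ : L →ₗ[R] K := φ.restrictScalars R ∘ₗ TensorProduct.mk R K L 1
  have hψ : ψ ≠ 0 := by
    intro h
    have : φ = 0 := TensorProduct.AlgebraTensorModule.ext fun k l ↦ by
      have h1 : φ (1 ⊗ₜ l) = 0 := LinearMap.congr_fun h l
      have h2 : (k ⊗ₜ l : TensorProduct R K L) = k • (1 ⊗ₜ l) := by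
        rw [TensorProduct.smul_tmul', smul_eq_mul, mul_one]
      rw [h2, map_smul, h1, smul_zero, LinearMap.zero_apply]
    exact hφ (by rw [this, LinearMap.zero_apply])
  obtain ⟨s, hs⟩ := Module.Finite.fg_top (R := R) (M := L)
  obtain ⟨b, hb⟩ := IsLocalization.exist_integer_multiples_of_finset (R ⧸ p.asIdeal)⁰ (s.image ψ)
  let c : K := algebraMap (R ⧸ p.asIdeal) K b
  have hc : c ≠ 0 := IsFractionRing.to_map_ne_zero_of_mem_nonZeroDivisors b.2
  let ι : (R ⧸ p.asIdeal) →ₗ[R] K := (IsScalarTower.toAlgHom R (R ⧸ p.asIdeal) K).toLinearMap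
  have hι : Function.Injective ι := IsFractionRing.injective (R ⧸ p.asIdeal) K
  let θ : L →ₗ[R] K := LinearMap.mulLeft R c ∘ₗ ψ
  have hθ (l : L) : θ l ∈ ι.range := by
    have : (⊤ : Submodule R L) ≤ ι.range.comap θ := by
      rw [← hs, Submodule.span_le]
      intro l hl
      obtain ⟨d, hd⟩ := hb _ (Finset.mem_image_of_mem ψ hl)
      exact ⟨d, hd.trans (Algebra.smul_def _ _)⟩
    exact this Submodule.mem_top
  refine ⟨(LinearEquiv.ofInjective ι hι).symm.toLinearMap ∘ₗ θ.codRestrict _ hθ, fun h ↦ hψ ?_⟩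
  ext l
  have h1 : (LinearEquiv.ofInjective ι hι).symm (θ.codRestrict _ hθ l) = 0 :=
    LinearMap.congr_fun h l
  rw [LinearEquiv.map_eq_zero_iff] at h1
  exact (mul_eq_zero.mp congr($(h1).1)).resolve_left hc

namespace localCohomology

variable {𝔞 : Ideal R} {i : ℕ}

lemma subsingleton_obj (M : ModuleCat.{u} R) [Subsingleton M] :
    Subsingleton ((localCohomology 𝔞 (i + 1)).obj M) := by
  refine subsingleton_of_forall_eq 0 fun y ↦ ?_
  obtain ⟨n, a, rfl⟩ := exists_ofExt_eq y
  have h : 𝟙 M = 0 := (ModuleCat.isZero_of_subsingleton M).eq_of_src _ _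
  rw [← a.comp_mk₀_id, h, Abelian.Ext.mk₀_zero, Abelian.Ext.comp_zero, map_zero]

lemma isArtinian_of_linearEquiv {A B : Type u} [AddCommGroup A] [AddCommGroup B] [Module R A]
    [Module R B] (e : A ≃ₗ[R] B)
    [IsArtinian R ((localCohomology 𝔞 i).obj (ModuleCat.of R A))] :
    IsArtinian R ((localCohomology 𝔞 i).obj (ModuleCat.of R B)) :=
  isArtinian_of_surjective _ ((localCohomology 𝔞 i).mapIso e.toModuleIso).toLinearEquiv.toLinearMap
    (LinearEquiv.surjective _)

section Exact

variable {A B C : Type u} [AddCommGroup A] [AddCommGroup B] [AddCommGroup C] [Module R A]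
  [Module R B] [Module R C] {f : A →ₗ[R] B} {g : B →ₗ[R] C} (hf : Function.Injective f)
  (hg : Function.Surjective g) (h : Function.Exact f g)
include hf hg h

lemma shortExact_of_exact :
    (ModuleCat.shortComplexOfCompEqZero f g h.linearMap_comp_eq_zero).ShortExact :=
  ModuleCat.shortComplex_shortExact _ h hf hg

lemma isArtinian_of_exact [IsArtinian R ((localCohomology 𝔞 (i + 1)).obj (ModuleCat.of R A))]
    [IsArtinian R ((localCohomology 𝔞 (i + 1)).obj (ModuleCat.of R C))] :
    IsArtinian R ((localCohomology 𝔞 (i + 1)).obj (ModuleCat.of R B)) :=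
  isArtinian_X₂ (shortExact_of_exact hf hg h)

lemma isArtinian_right_of_exact
    [IsArtinian R ((localCohomology 𝔞 (i + 1)).obj (ModuleCat.of R B))]
    [IsArtinian R ((localCohomology 𝔞 (i + 1 + 1)).obj (ModuleCat.of R A))] :
    IsArtinian R ((localCohomology 𝔞 (i + 1)).obj (ModuleCat.of R C)) :=
  isArtinian_X₃ (shortExact_of_exact hf hg h)

end Exact

variable [IsNoetherianRing R]

lemma isArtinian_of_forall_mem_support (N : Type u) [AddCommGroup N] [Module R N]
    [hN : Module.Finite R N]
    (h : ∀ p ∈ Module.support R N,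
      IsArtinian R ((localCohomology 𝔞 (i + 1)).obj (ModuleCat.of R (R ⧸ p.asIdeal)))) :
    IsArtinian R ((localCohomology 𝔞 (i + 1)).obj (ModuleCat.of R N)) := by
  induction hN using IsNoetherianRing.induction_on_isQuotientEquivQuotientPrime R with
  | subsingleton N =>
    have := subsingleton_obj (𝔞 := 𝔞) (i := i) (ModuleCat.of R N)
    infer_instance
  | quotient N p e =>
    have := h p (by rw [Module.mem_support_iff_of_finite, e.annihilator_eq,
      Ideal.annihilator_quotient])
    exact isArtinian_of_linearEquiv e.symm
  | exact A B C f g hf hg hfg hA hC =>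
    have := hA fun p hp ↦ h p (Module.support_subset_of_injective f hf hp)
    have := hC fun p hp ↦ h p (Module.support_subset_of_surjective g hg hp)
    exact isArtinian_of_exact hf hg hfg

variable {L : Type u} [AddCommGroup L] [Module R L] [Module.Finite R L]

lemma isArtinian_quotient_of_mem_support
    [IsArtinian R ((localCohomology 𝔞 (i + 1)).obj (ModuleCat.of R L))]
    (hnext : ∀ (N : Type u) [AddCommGroup N] [Module R N] [Module.Finite R N],
      Module.support R N ⊆ Module.support R L →
        IsArtinian R ((localCohomology 𝔞 (i + 1 + 1)).obj (ModuleCat.of R N)))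
    (p : PrimeSpectrum R) (hp : p ∈ Module.support R L) :
    IsArtinian R ((localCohomology 𝔞 (i + 1)).obj (ModuleCat.of R (R ⧸ p.asIdeal))) := by
  have : WellFoundedGT (PrimeSpectrum R) := ⟨InvImage.wf PrimeSpectrum.asIdeal
    (wellFounded_gt (α := Ideal R))⟩
  induction p using WellFoundedGT.induction with
  | ind p ih =>
  obtain ⟨f, hf⟩ := Module.exists_linearMap_quotient_ne_zero hp
  have := hnext f.ker (Module.support_subset_of_injective f.ker.subtype f.ker.injective_subtype)
  have : IsArtinian R ((localCohomology 𝔞 (i + 1)).obj (ModuleCat.of R f.range)) :=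
    isArtinian_right_of_exact f.ker.injective_subtype f.surjective_rangeRestrict
      (LinearMap.exact_iff.mpr (by simp))
  have : IsArtinian R ((localCohomology 𝔞 (i + 1)).obj
      (ModuleCat.of R ((R ⧸ p.asIdeal) ⧸ f.range))) := by
    refine isArtinian_of_forall_mem_support _ fun q hq ↦ ?_
    have hpq : p ≤ q := by
      have := Module.support_subset_of_surjective f.range.mkQ f.range.mkQ_surjective hq
      rwa [Module.mem_support_iff_of_finite, Ideal.annihilator_quotient] at this
    refine ih q (lt_of_le_of_ne hpq ?_) (Module.mem_support_mono hpq hp)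
    rintro rfl
    refine hf (LinearMap.ext fun l ↦ ?_)
    obtain ⟨r, hr⟩ := Ideal.Quotient.mk_surjective (f l)
    rw [LinearMap.zero_apply, ← hr, Ideal.Quotient.eq_zero_iff_mem]
    refine Module.annihilator_le_of_mem_support hq (Module.mem_annihilator.mpr fun y ↦ ?_)
    obtain ⟨y, rfl⟩ := Submodule.Quotient.mk_surjective _ y
    obtain ⟨y, rfl⟩ := Ideal.Quotient.mk_surjective y
    rw [← Submodule.Quotient.mk_smul, Submodule.Quotient.mk_eq_zero]
    refine ⟨y • l, ?_⟩
    rw [map_smul, ← hr, Algebra.smul_def, Algebra.smul_def, mul_comm]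
    rfl
  exact isArtinian_of_exact f.range.injective_subtype f.range.mkQ_surjective
    (LinearMap.exact_subtype_mkQ _)

end localCohomology

end

theorem artinianness_dim_le_of_support_subset
    {R : Type u} [CommRing R] [IsNoetherianRing R] (𝔞 : Ideal R)
    (N : Type u) [AddCommGroup N] [Module R N] [Module.Finite R N]
    (L : Type u) [AddCommGroup L] [Module R L] [Module.Finite R L]
    (h_supp : Module.support R N ⊆ Module.support R L)
    (t : ℕ)
    (h_art : ∀ i, t < i → IsArtinian R ((localCohomology 𝔞 i).obj (ModuleCat.of R L))) :
    ∀ i, t < i → IsArtinian R ((localCohomology 𝔞 i).obj (ModuleCat.of R N)) := by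
  obtain ⟨r, hr⟩ := localCohomology.exists_forall_subsingleton 𝔞
  suffices ∀ k i, t < i → r < i + k → ∀ (N : Type u) [AddCommGroup N] [Module R N]
      [Module.Finite R N], Module.support R N ⊆ Module.support R L →
        IsArtinian R ((localCohomology 𝔞 i).obj (ModuleCat.of R N)) from
    fun i hi ↦ this (r + 1) i hi (by lia) N h_supp
  intro k
  induction k with
  | zero =>
    intro i _ hi N _ _ _ _
    have := hr i hi (ModuleCat.of R N)
    infer_instance
  | succ k ih =>
    intro i hti hi N _ _ _ hN
    have hL := h_art i hti
    obtain ⟨i, rfl⟩ := Nat.exists_eq_succ_of_ne_zero (Nat.ne_zero_of_lt hti)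
    exact localCohomology.isArtinian_of_forall_mem_support N fun p hp ↦
      localCohomology.isArtinian_quotient_of_mem_support
        (fun N _ _ _ ↦ ih (i + 1 + 1) (by lia) (by lia) N) p (hN hp)
end
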